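/- For every strictly decreasing sequence of n−1 integers z_1 > z_2 > ... > z_{n−1}, there exists a vector bundle on projective space P^{n−1} over K with supernatural cohomology whose root sequence is (z_1,...,z_{n−1}). -/

import Mathlib

open MvPolynomial Finset Module

noncomputable section

/-- The standard graded polynomial ring `S = K[x_1, …, x_n]`. -/
abbrev PolyS (K : Type) [Field K] (n : ℕ) : Type := MvPolynomial (Fin n) K

/-- The `K`-subspace of homogeneous polynomials of integer degree `z`
(it is `0` if `z < 0`). -/
def homogZ (K : Type) [Field K] (n : ℕ) (z : ℤ) : Submodule K (PolyS K n) :=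
  ⨆ (_ : 0 ≤ z), MvPolynomial.homogeneousSubmodule (Fin n) K z.toNat

/-- The degree-`ℓ` piece of the graded free module `⊕ₚ S(-dg p)`. -/
def freePiece {K : Type} [Field K] {n r : ℕ} (dg : Fin r → ℤ) (ℓ : ℤ) :
    Submodule K (Fin r → PolyS K n) :=
  Submodule.pi Set.univ fun p => homogZ K n (ℓ - dg p)

/-- A (homologically indexed) finite complex of graded free `S`-modules
`F₀ ← F₁ ← ⋯ ← F_len ← 0`, where `Fᵢ = ⊕ₚ S(-deg i p)` and the (degree `0`)
map `Fᵢ₊₁ → Fᵢ` is given by the matrix `dd i`, whose entries are homogeneous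
of the appropriate degrees. -/
structure FreeComplex (K : Type) [Field K] (n : ℕ) where
  len : ℕ
  rk : ℕ → ℕ
  deg : (i : ℕ) → Fin (rk i) → ℤ
  dd : (i : ℕ) → Matrix (Fin (rk i)) (Fin (rk (i+1))) (PolyS K n)
  rk_eq_zero : ∀ i, len < i → rk i = 0
  isHomog : ∀ i p q, dd i p q ∈ homogZ K n (deg (i+1) q - deg i p)
  isComplex : ∀ i, dd i * dd (i+1) = 0

variable {K : Type} [Field K] {n : ℕ}

/-- `F` is exact in positive homological degrees; that is, it is a graded free
resolution of the finitely generated graded module `M = coker (F₁ → F₀)`. -/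
def IsResolution (F : FreeComplex K n) : Prop :=
  ∀ i, LinearMap.ker ((F.dd i).mulVecLin) = LinearMap.range ((F.dd (i+1)).mulVecLin)

/-- The complex is minimal: entries of the differentials lie in the maximal ideal,
i.e. all (constant) entries between generators of equal degrees vanish. -/
def IsMinimal (F : FreeComplex K n) : Prop :=
  ∀ i p q, F.deg (i+1) q = F.deg i p → F.dd i p q = 0

/-- Betti number `β_{i,j}`: the number of generators of `Fᵢ` of degree `j`. -/
def bettiNum (F : FreeComplex K n) (i : ℕ) (j : ℤ) : ℕ :=
  (Finset.univ.filter fun p => F.deg i p = j).card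

/-- The dimension of the degree-`ℓ` piece of the module `M = coker (F₁ → F₀)`
resolved by `F`. -/
def MPieceDim (F : FreeComplex K n) (ℓ : ℤ) : ℕ :=
  finrank K ((freePiece (F.deg 0) ℓ) ⧸
    (Submodule.comap (freePiece (F.deg 0) ℓ).subtype
      ((LinearMap.range ((F.dd 0).mulVecLin)).restrictScalars K)))

/-- The Hilbert polynomial of the twisted free module `S(-a)` in `n` variables:
`binom (t - a + n - 1, n - 1)`. -/
def genHilb (n : ℕ) (a : ℤ) : Polynomial ℚ :=
  if n = 0 then 0 else
    Polynomial.C (((n - 1).factorial : ℚ))⁻¹ *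
      ∏ k ∈ Finset.range (n - 1),
        (Polynomial.X - Polynomial.C (a : ℚ) + Polynomial.C ((k : ℚ) + 1))

/-- The Hilbert polynomial of `M = coker (F₁ → F₀)`, computed from the free
resolution `F` by additivity. -/
def hilbPoly (F : FreeComplex K n) : Polynomial ℚ :=
  ∑ i ∈ Finset.range (F.len + 1),
    Polynomial.C ((-1 : ℚ) ^ i) * ∑ p : Fin (F.rk i), genHilb n (F.deg i p)

/-- The Krull dimension of a module read off from its Hilbert polynomial:
`0` for the zero polynomial (finite length), `deg + 1` otherwise. -/
def polyDim (P : Polynomial ℚ) : ℕ := if P = 0 then 0 else P.natDegree + 1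

/-- `M = coker (F₁ → F₀)` is a Cohen-Macaulay module of codimension `c`:
`F` is a minimal free resolution of length exactly `c` (so `pd M = c`, and by
Auslander–Buchsbaum `depth M = n - c`) and `dim M = n - c`. -/
def IsCMcodim (F : FreeComplex K n) (c : ℕ) : Prop :=
  IsResolution F ∧ IsMinimal F ∧ (∀ i, c < i → F.rk i = 0) ∧ F.rk c ≠ 0 ∧
    polyDim (hilbPoly F) = n - c

/-- The multiplicity `e(M)` of a module of codimension `c`, computed from the
Betti numbers of a free resolution:
`e(M) = ((-1)^c / c!) ⬝ Σ_{i,j} (-1)^i β_{i,j} j^c`. -/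
def multQ (F : FreeComplex K n) (c : ℕ) : ℚ :=
  ((-1 : ℚ) ^ c / c.factorial) *
    ∑ i ∈ Finset.range (F.len + 1),
      (-1 : ℚ) ^ i * ∑ p : Fin (F.rk i), ((F.deg i p : ℚ)) ^ c


/-- A (cohomologically indexed) finite complex of graded free `S`-modules
`0 → E⁰ → E¹ → ⋯ → E^len → 0`, where `Eⁱ = ⊕ₚ S(-deg i p)` and the (degree `0`)
map `Eⁱ → Eⁱ⁺¹` is given by the matrix `dd i`. -/
structure CoComplex (K : Type) [Field K] (n : ℕ) where
  len : ℕ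
  rk : ℕ → ℕ
  deg : (i : ℕ) → Fin (rk i) → ℤ
  dd : (i : ℕ) → Matrix (Fin (rk (i+1))) (Fin (rk i)) (PolyS K n)
  rk_eq_zero : ∀ i, len < i → rk i = 0
  isHomog : ∀ i p q, dd i p q ∈ homogZ K n (deg i q - deg (i+1) p)
  isComplex : ∀ i, dd (i+1) * dd i = 0

/-- The degree-`ℓ` part of the cocycles at cohomological position `i`. -/
def CoComplex.kerPiece (E : CoComplex K n) (i : ℕ) (ℓ : ℤ) :
    Submodule K (Fin (E.rk i) → PolyS K n) :=
  ((LinearMap.ker ((E.dd i).mulVecLin)).restrictScalars K) ⊓ freePiece (E.deg i) ℓ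

/-- The coboundaries at cohomological position `i` (as a `K`-subspace). -/
def CoComplex.imSub (E : CoComplex K n) : (i : ℕ) → Submodule K (Fin (E.rk i) → PolyS K n)
  | 0 => ⊥
  | (j+1) => (LinearMap.range ((E.dd j).mulVecLin)).restrictScalars K

/-- `dim_K (Hⁱ(E))_ℓ`, the dimension of the degree-`ℓ` component of the `i`-th
cohomology module of the complex `E`. -/
def cohomDim (E : CoComplex K n) (i : ℕ) (ℓ : ℤ) : ℕ :=
  finrank K ((E.kerPiece i ℓ) ⧸
    (Submodule.comap (E.kerPiece i ℓ).subtype (E.imSub i)))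

/-- The bilinear pairing `⟨F, E⟩ = Σ_{j ≤ i, k} (-1)^{i-j} β_{i,k}(F) ⬝ dim_K (H^j E)_{-k}`
of a free resolution `F` against a free cocomplex `E`. -/
def pairing (F : FreeComplex K n) (E : CoComplex K n) : ℤ :=
  ∑ i ∈ Finset.range (F.len + 1), ∑ j ∈ Finset.range (i + 1),
    (-1 : ℤ) ^ (i - j) * ∑ p : Fin (F.rk i), (cohomDim E j (-(F.deg i p)) : ℤ)

/-- The modified pairing `⟨F, E⟩_{c,τ}`: terms with `j ≤ i` are kept when `j < τ`
or `j ≤ i - 2`, and the terms with `j = τ`, `i = τ + ε` (`ε ∈ {0,1}`) are kept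
only when the degree `k` of the generator satisfies `k ≤ c + ε`. -/
def pairingMod (F : FreeComplex K n) (E : CoComplex K n) (c : ℤ) (τ : ℕ) : ℤ :=
  (∑ i ∈ Finset.range (F.len + 1), ∑ j ∈ Finset.range (i + 1),
    if j < τ ∨ j + 2 ≤ i then
      (-1 : ℤ) ^ (i - j) * ∑ p : Fin (F.rk i), (cohomDim E j (-(F.deg i p)) : ℤ)
    else 0) +
  ∑ ε ∈ Finset.range 2,
    (-1 : ℤ) ^ ε * ∑ p ∈ Finset.univ.filter (fun p => F.deg (τ + ε) p ≤ c + ε),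
      (cohomDim E τ (-(F.deg (τ + ε) p)) : ℤ)

/-- The dual cocomplex `Hom(F, S)`: `0 → F₀^∨ → F₁^∨ → ⋯`. Its `j`-th cohomology
is `Ext^j_S(M, S)` for the module `M` resolved by `F`. -/
def dualCo (F : FreeComplex K n) : CoComplex K n where
  len := F.len
  rk := F.rk
  deg := fun i p => -F.deg i p
  dd := fun i => (F.dd i).transpose
  rk_eq_zero := F.rk_eq_zero
  isHomog := by
    intro i p q
    have h := F.isHomog i q p
    rw [neg_sub_neg]
    exact h
  isComplex := by
    intro i
    rw [← Matrix.transpose_mul, F.isComplex i, Matrix.transpose_zero]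

/-- `dim_K Ext^j_S(M, S)_e`, where `M = coker (F₁ → F₀)` (zero for `j < 0`). -/
def extDim (F : FreeComplex K n) (j : ℤ) (e : ℤ) : ℕ :=
  if 0 ≤ j then cohomDim (dualCo F) j.toNat e else 0

/-- `h^i(𝓔(d)) = dim_K H^i(ℙ^{n-1}, 𝓔(d))` for the coherent sheaf `𝓔 = M~` on
`ℙ^{n-1}` associated to the module `M = coker (F₁ → F₀)` resolved by `F`,
expressed via graded local duality:
`h^i(𝓔(d)) = dim Ext^{n-1-i}(M,S)_{-d-n}` for `i ≥ 1`, and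
`h^0(𝓔(d)) = dim M_d - dim Ext^{n}(M,S)_{-d-n} + dim Ext^{n-1}(M,S)_{-d-n}`. -/
def sheafH (F : FreeComplex K n) (i : ℕ) (d : ℤ) : ℕ :=
  if i = 0 then
    MPieceDim F d - extDim F (n : ℤ) (-d - n) + extDim F ((n : ℤ) - 1) (-d - n)
  else extDim F ((n : ℤ) - 1 - i) (-d - n)

/-- The ideal generated by the `s × s` minors of a matrix. -/
def minorsIdeal {a b : ℕ} (M : Matrix (Fin a) (Fin b) (PolyS K n)) (s : ℕ) :
    Ideal (PolyS K n) :=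
  Ideal.span (Set.range fun fg : (Fin s ↪ Fin a) × (Fin s ↪ Fin b) =>
    (M.submatrix fg.1 fg.2).det)

/-- The `r`-th Fitting ideal of `M = coker (F₁ → F₀)`: the ideal of
`(rk F₀ - r)`-minors of the presentation matrix. -/
def fittingIdeal (F : FreeComplex K n) (r : ℤ) : Ideal (PolyS K n) :=
  if (F.rk 0 : ℤ) - r ≤ 0 then ⊤ else minorsIdeal (F.dd 0) ((F.rk 0 : ℤ) - r).toNat

/-- The irrelevant maximal ideal `(x_1, …, x_n)` of `S`. -/
def irrel (K : Type) [Field K] (n : ℕ) : Ideal (PolyS K n) :=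
  Ideal.span (Set.range (MvPolynomial.X : Fin n → PolyS K n))

/-- The coherent sheaf `M~` on `ℙ^{n-1}` associated to `M = coker (F₁ → F₀)` is a
locally free sheaf (vector bundle) of rank `r`: the Fitting ideal `Fitt_{r-1}(M)`
is zero and `Fitt_r(M)` contains a power of the irrelevant ideal. -/
def IsVectorBundle (F : FreeComplex K n) (r : ℕ) : Prop :=
  fittingIdeal F ((r : ℤ) - 1) = ⊥ ∧ ∃ N : ℕ, (irrel K n) ^ N ≤ fittingIdeal F r

/-- The rank of a sheaf of dimension `s`: the normalized leading coefficient of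
its Hilbert polynomial, `χ(𝓔(d)) = (rank 𝓔 / s!) d^s + O(d^{s-1})`. -/
def sheafRank (F : FreeComplex K n) (s : ℕ) : ℚ :=
  (s.factorial : ℚ) * (hilbPoly F).coeff s

/-- The sheaf `M~` has natural cohomology: for each `d` at most one `h^i(𝓔(d))`
is nonzero. -/
def HasNaturalCohomology (F : FreeComplex K n) : Prop :=
  ∀ (d : ℤ) (i i' : ℕ), sheafH F i d ≠ 0 → sheafH F i' d ≠ 0 → i = i'

/-- The sheaf `𝓔 = M~` (of dimension `s`) has supernatural cohomology with root
sequence `z_1 > ⋯ > z_s`: it has natural cohomology and its Hilbert polynomial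
`d ↦ χ(𝓔(d))` has the distinct integral roots `z_1 > ⋯ > z_s`. -/
def IsSupernaturalWithRoots (F : FreeComplex K n) {s : ℕ} (z : Fin s → ℤ) : Prop :=
  StrictAnti z ∧ HasNaturalCohomology F ∧
    ∃ a : ℚ, a ≠ 0 ∧
      hilbPoly F = Polynomial.C a * ∏ i : Fin s, (Polynomial.X - Polynomial.C ((z i : ℚ)))

end

open MvPolynomial Finset Module
noncomputable section
namespace SNB

section koszul
variable {K : Type} [Field K] {n : ℕ} {N N' : Type} [AddCommGroup N] [Module K N]
  [AddCommGroup N'] [Module K N']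

/-- Koszul sign. -/
def ksgn (i : Fin n) (T : Finset (Fin n)) : ℤ := (-1) ^ (T.filter (· < i)).card

lemma ksgn_insert {i l : Fin n} {T : Finset (Fin n)} (h : l ∉ T) :
    ksgn i (insert l T) = if l < i then - ksgn i T else ksgn i T := by
  unfold ksgn
  rw [Finset.filter_insert]
  split_ifs with h1
  · rw [Finset.card_insert_of_notMem (by simp [h]), pow_succ]; ring
  · rfl

lemma ksgn_insert_self (i : Fin n) (T : Finset (Fin n)) : ksgn i (insert i T) = ksgn i T := by
  unfold ksgn
  rw [Finset.filter_insert]; simp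

lemma ksgn_erase_self (i : Fin n) (T : Finset (Fin n)) : ksgn i (T.erase i) = ksgn i T := by
  unfold ksgn
  congr 2
  ext l; simp only [mem_filter, mem_erase]; constructor
  · rintro ⟨⟨_, h⟩, h'⟩; exact ⟨h, h'⟩
  · rintro ⟨h, h'⟩; exact ⟨⟨h'.ne, h⟩, h'⟩

lemma ksgn_sq (i : Fin n) (T : Finset (Fin n)) : ksgn i T * ksgn i T = 1 := by
  unfold ksgn; rw [← mul_pow]; simp

/-- contraction -/
def con (K : Type) [Field K] {N : Type} [AddCommGroup N] [Module K N] (i : Fin n) :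
    (Finset (Fin n) → N) →ₗ[K] (Finset (Fin n) → N) where
  toFun ω T := if i ∈ T then 0 else ksgn i T • ω (insert i T)
  map_add' a b := by ext T; by_cases h : i ∈ T <;> simp [h]
  map_smul' c a := by
    ext T; by_cases h : i ∈ T
    · simp [h]
    · simp [h, smul_comm c (ksgn i T)]

/-- wedge -/
def wed (K : Type) [Field K] {N : Type} [AddCommGroup N] [Module K N] (i : Fin n) :
    (Finset (Fin n) → N) →ₗ[K] (Finset (Fin n) → N) where
  toFun ω T := if i ∈ T then ksgn i T • ω (T.erase i) else 0
  map_add' a b := by ext T; by_cases h : i ∈ T <;> simp [h]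
  map_smul' c a := by
    ext T; by_cases h : i ∈ T
    · simp [h, smul_comm c (ksgn i T)]
    · simp [h]

lemma con_apply (i : Fin n) (ω : Finset (Fin n) → N) (T) :
    con K i ω T = if i ∈ T then 0 else ksgn i T • ω (insert i T) := rfl
lemma wed_apply (i : Fin n) (ω : Finset (Fin n) → N) (T) :
    wed K i ω T = if i ∈ T then ksgn i T • ω (T.erase i) else 0 := rfl

lemma con_con_self (i : Fin n) (ω : Finset (Fin n) → N) : con K i (con K i ω) = 0 := by
  ext T; simp [con_apply]

lemma con_con (i l : Fin n) (ω : Finset (Fin n) → N) :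
    con K i (con K l ω) = - con K l (con K i ω) := by
  by_cases hil : i = l
  · subst hil; simp [con_con_self]
  ext T
  simp only [con_apply, Pi.neg_apply, mem_insert]
  by_cases hi : i ∈ T
  · simp [hi]
  by_cases hl : l ∈ T
  · simp [hl]
  simp only [hi, hl, hil, Ne.symm hil, or_false, if_false]
  rw [ksgn_insert hi, ksgn_insert hl, Finset.insert_comm, ← smul_assoc, ← smul_assoc, ← neg_smul]
  congr 1
  rcases lt_or_gt_of_ne hil with h | h
  · simp [h, h.not_gt]; ring
  · simp [h, h.not_gt]; ring

lemma con_wed_ne {i l : Fin n} (hil : i ≠ l) (ω : Finset (Fin n) → N) :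
    con K i (wed K l ω) = - wed K l (con K i ω) := by
  ext T
  simp only [con_apply, wed_apply, Pi.neg_apply, mem_insert, mem_erase]
  by_cases hi : i ∈ T
  · simp [hi, hil]
  by_cases hl : l ∈ T
  · simp only [hi, hl, hil, Ne.symm hil, if_false, if_true, false_or, and_false]
    have h1 : (insert i T).erase l = insert i (T.erase l) := by
      rw [Finset.erase_insert_of_ne hil]
    have h2 : ksgn i T = if l < i then - ksgn i (T.erase l) else ksgn i (T.erase l) := by
      conv_lhs => rw [← Finset.insert_erase hl]
      rw [ksgn_insert (by simp)]
    rw [h1, ksgn_insert hi, h2, ← smul_assoc, ← smul_assoc, ← neg_smul]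
    congr 1
    rcases lt_or_gt_of_ne hil with h | h
    · simp [h, h.not_gt]; ring
    · simp [h, h.not_gt]; ring
  · simp [hi, hl, Ne.symm hil]

lemma con_wed_self (i : Fin n) (ω : Finset (Fin n) → N) (T) :
    con K i (wed K i ω) T = if i ∈ T then 0 else ω T := by
  simp only [con_apply, wed_apply, mem_insert]
  by_cases hi : i ∈ T
  · simp [hi]
  · simp [hi, ksgn_insert_self, ← mul_smul, ksgn_sq]

lemma wed_con_self (i : Fin n) (ω : Finset (Fin n) → N) (T) :
    wed K i (con K i ω) T = if i ∈ T then ω T else 0 := by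
  simp only [con_apply, wed_apply]
  by_cases hi : i ∈ T
  · simp [hi, ksgn_erase_self, ← mul_smul, ksgn_sq]
  · simp [hi]

/-- pointwise application -/
def pw (f : N →ₗ[K] N') : (Finset (Fin n) → N) →ₗ[K] (Finset (Fin n) → N') :=
  f.compLeft _

@[simp] lemma pw_apply (f : N →ₗ[K] N') (ω : Finset (Fin n) → N) (T) : pw f ω T = f (ω T) := rfl

lemma con_pw (f : N →ₗ[K] N') (i : Fin n) (ω : Finset (Fin n) → N) :
    con K i (pw f ω) = pw f (con K i ω) := by
  ext T; simp only [con_apply, pw_apply]; split_ifs <;> simp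

lemma wed_pw (f : N →ₗ[K] N') (i : Fin n) (ω : Finset (Fin n) → N) :
    wed K i (pw f ω) = pw f (wed K i ω) := by
  ext T; simp only [wed_apply, pw_apply]; split_ifs <;> simp

/-- Koszul differential -/
def kd (x : Fin n → N →ₗ[K] N) : (Finset (Fin n) → N) →ₗ[K] (Finset (Fin n) → N) :=
  ∑ i, con K i ∘ₗ pw (x i)

lemma kd_eq (x : Fin n → N →ₗ[K] N) (ω : Finset (Fin n) → N) :
    kd x ω = ∑ i, con K i (pw (x i) ω) := by
  simp [kd, LinearMap.sum_apply]

lemma kd_apply (x : Fin n → N →ₗ[K] N) (ω : Finset (Fin n) → N) (T) :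
    kd x ω T = ∑ i, if i ∈ T then 0 else ksgn i T • x i (ω (insert i T)) := by
  rw [kd_eq, Finset.sum_apply]; rfl

lemma kd_kd_anti (x y : Fin n → N →ₗ[K] N) (h : ∀ i l v, x i (y l v) = y l (x i v))
    (ω : Finset (Fin n) → N) : kd x (kd y ω) = - kd y (kd x ω) := by
  simp only [kd_eq, map_sum]
  rw [Finset.sum_comm, ← Finset.sum_neg_distrib]
  refine Finset.sum_congr rfl fun l _ => ?_
  rw [← Finset.sum_neg_distrib]
  refine Finset.sum_congr rfl fun i _ => ?_
  rw [← con_pw, ← con_pw, con_con]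
  congr 3
  ext T; simp [h]

lemma con_con_sum_zero (f : Fin n → Fin n → (Finset (Fin n) → N)) (hf : ∀ i l, f i l = f l i) :
    ∑ i, ∑ l, con K i (con K l (f i l)) = 0 := by
  have key : ∀ p ∈ (Finset.univ : Finset (Fin n × Fin n)),
    con K p.1 (con K p.2 (f p.1 p.2)) + con K (p.swap).1 (con K p.swap.2 (f p.swap.1 p.swap.2)) = 0 := by
    rintro ⟨i, l⟩ _
    simp only [Prod.swap, hf l i]
    rw [con_con]; simp
  rw [← Finset.sum_product', Finset.univ_product_univ]
  refine Finset.sum_involution (fun p _ => p.swap) key ?_ (by simp) (by simp)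
  rintro ⟨i, l⟩ _ hne heq
  simp only [Prod.swap, Prod.mk.injEq] at heq
  obtain ⟨h1, h2⟩ := heq
  subst h1
  exact hne (con_con_self _ _)

lemma kd_kd (x : Fin n → N →ₗ[K] N) (h : ∀ i l v, x i (x l v) = x l (x i v))
    (ω : Finset (Fin n) → N) : kd x (kd x ω) = 0 := by
  rw [kd_eq]
  simp only [kd_eq x ω, map_sum, ← con_pw]
  apply con_con_sum_zero
  intro i l; ext T; simp [h]

/-- homotopy formula -/
lemma homot (x : Fin n → N →ₗ[K] N) (k : Fin n) (Z : N →ₗ[K] N)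
    (h : ∀ i, i ≠ k → ∀ v, Z (x i v) = x i (Z v)) (ω : Finset (Fin n) → N) (T) :
    kd x (wed K k (pw Z ω)) T + wed K k (pw Z (kd x ω)) T =
      if k ∈ T then Z (x k (ω T)) else x k (Z (ω T)) := by
  rw [kd_eq, kd_eq, ← Pi.add_apply]
  simp only [map_sum, ← Finset.sum_add_distrib]
  rw [Finset.sum_eq_single k]
  · rw [Pi.add_apply, ← wed_pw, con_wed_self, ← con_pw, wed_con_self]
    split_ifs <;> simp
  · intro i _ hi
    rw [← wed_pw, con_wed_ne hi, ← con_pw]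
    have : pw Z (pw (x i) ω) = pw (x i) (pw Z ω) := by ext T; simp [h i hi]
    rw [this]; simp
  · simp

lemma homot_id (x : Fin n → N →ₗ[K] N) (k : Fin n) (ω : Finset (Fin n) → N) :
    kd x (wed K k ω) + wed K k (kd x ω) = pw (x k) ω := by
  ext T
  have := homot x k LinearMap.id (by simp) ω T
  rw [LinearMap.id_apply, LinearMap.id_apply, ite_self] at this
  exact this

lemma kd_pw (x : Fin n → N →ₗ[K] N) (y : Fin n → N' →ₗ[K] N') (f : N →ₗ[K] N')
    (h : ∀ i v, f (x i v) = y i (f v)) (ω : Finset (Fin n) → N) :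
    kd y (pw f ω) = pw f (kd x ω) := by
  simp only [kd_eq, map_sum]
  refine Finset.sum_congr rfl fun i _ => ?_
  rw [← con_pw]; congr 1; ext T; simp [h]

/-- chains -/
def Ch (A : Submodule K N) (j : ℕ) : Submodule K (Finset (Fin n) → N) where
  carrier := {ω | ∀ T, ω T ∈ A ∧ (T.card ≠ j → ω T = 0)}
  add_mem' := by
    intro a b ha hb T
    refine ⟨A.add_mem (ha T).1 (hb T).1, fun h => ?_⟩
    simp [(ha T).2 h, (hb T).2 h]
  zero_mem' := by intro T; simp
  smul_mem' := by
    intro c a ha T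
    refine ⟨A.smul_mem c (ha T).1, fun h => ?_⟩
    simp [(ha T).2 h]

lemma mem_Ch {A : Submodule K N} {j : ℕ} {ω : Finset (Fin n) → N} :
    ω ∈ Ch A j ↔ ∀ T, ω T ∈ A ∧ (T.card ≠ j → ω T = 0) := Iff.rfl

lemma zsmul_mem' {A : Submodule K N} {v : N} (h : v ∈ A) (c : ℤ) : c • v ∈ A :=
  A.toAddSubgroup.zsmul_mem h c

lemma con_mem {A : Submodule K N} {j : ℕ} {ω : Finset (Fin n) → N} (h : ω ∈ Ch A (j+1)) (i) :
    con K i ω ∈ Ch A j := by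
  intro T
  rw [con_apply]
  split_ifs with hi
  · simp
  · refine ⟨zsmul_mem' (h _).1 _, fun hT => ?_⟩
    rw [(h _).2 (by rw [Finset.card_insert_of_notMem hi]; omega), smul_zero]

lemma wed_mem {A : Submodule K N} {j : ℕ} {ω : Finset (Fin n) → N} (h : ω ∈ Ch A j) (i) :
    wed K i ω ∈ Ch A (j+1) := by
  intro T
  rw [wed_apply]
  split_ifs with hi
  · refine ⟨zsmul_mem' (h _).1 _, fun hT => ?_⟩
    have := Finset.card_pos.2 ⟨i, hi⟩
    rw [(h _).2 (by rw [Finset.card_erase_of_mem hi]; omega), smul_zero]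
  · simp

lemma pw_mem {A : Submodule K N} {B : Submodule K N'} {f : N →ₗ[K] N'} (hf : ∀ v ∈ A, f v ∈ B)
    {j : ℕ} {ω : Finset (Fin n) → N} (h : ω ∈ Ch A j) : pw f ω ∈ Ch B j := by
  intro T
  exact ⟨hf _ (h T).1, fun hT => by simp [(h T).2 hT]⟩

lemma Ch_mono {A B : Submodule K N} (h : A ≤ B) {j : ℕ} : Ch (n := n) A j ≤ Ch B j :=
  fun _ hω T => ⟨h (hω T).1, (hω T).2⟩

lemma kd_mem {A B : Submodule K N} {x : Fin n → N →ₗ[K] N} (hx : ∀ i, ∀ v ∈ A, x i v ∈ B)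
    {j : ℕ} {ω : Finset (Fin n) → N} (h : ω ∈ Ch A (j+1)) : kd x ω ∈ Ch B j := by
  rw [kd_eq]
  exact Submodule.sum_mem _ fun i _ => con_mem (pw_mem (hx i) h) i

lemma con_zero_of_mem {A : Submodule K N} {ω : Finset (Fin n) → N} (h : ω ∈ Ch A 0) (i) :
    con K i ω = 0 := by
  ext T; rw [con_apply]; split_ifs with hi
  · rfl
  · rw [(h _).2 (by rw [Finset.card_insert_of_notMem hi]; omega)]; simp

lemma kd_zero_of_mem {A : Submodule K N} {x : Fin n → N →ₗ[K] N}
     {ω : Finset (Fin n) → N} (h : ω ∈ Ch A 0) : kd x ω = 0 := by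
  rw [kd_eq]
  refine Finset.sum_eq_zero fun i _ => con_zero_of_mem (A := ⊤) (pw_mem (by simp) h) i

lemma Ch_eq_zero {A : Submodule K N} {j : ℕ} (hj : n < j) {ω : Finset (Fin n) → N}
    (h : ω ∈ Ch A j) : ω = 0 := by
  ext T; refine (h T).2 ?_
  have := Finset.card_le_univ T
  simp at this; omega

/-- exactness -/
def Ex (x : Fin n → N →ₗ[K] N) (A : ℤ → Submodule K N) (d : ℤ) (j : ℕ) : Prop :=
  ∀ ω ∈ Ch (A d) j, kd x ω = 0 → ∃ η ∈ Ch (A (d-1)) (j+1), kd x η = ω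

lemma Ex_of_bot {x : Fin n → N →ₗ[K] N} {A : ℤ → Submodule K N} {d : ℤ} {j : ℕ}
    (h : ∀ v ∈ A d, v = 0) : Ex x A d j := by
  intro ω hω _
  refine ⟨0, Submodule.zero_mem _, ?_⟩
  rw [map_zero]; ext T; exact (h _ (hω T).1).symm

lemma Ex_of_gt {x : Fin n → N →ₗ[K] N} {A : ℤ → Submodule K N} {d : ℤ} {j : ℕ}
    (h : n < j) : Ex x A d j := by
  intro ω hω _
  refine ⟨0, Submodule.zero_mem _, ?_⟩
  rw [map_zero, Ch_eq_zero h hω]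

end koszul
end SNB
end

noncomputable section
namespace SNB

section ses
variable {K : Type} [Field K] {n : ℕ} {N : Type} [AddCommGroup N] [Module K N]

structure SES (x y : Fin n → N →ₗ[K] N) (A B C : ℤ → Submodule K N) (f g : N →ₗ[K] N) : Prop where
  xcomm : ∀ i l v, x i (x l v) = x l (x i v)
  fx : ∀ i v, f (x i v) = x i (f v)
  gx : ∀ i v, g (x i v) = y i (g v)
  fA : ∀ d, ∀ v ∈ A d, f v ∈ B d
  gB : ∀ d, ∀ v ∈ B d, g v ∈ C d
  finj : Function.Injective f
  gf : ∀ v, g (f v) = 0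
  CB : ∀ d, C d ≤ B d
  gC : ∀ d, ∀ v ∈ C d, g v = v
  ker : ∀ d, ∀ v ∈ B d, g v = 0 → ∃ u ∈ A d, f u = v
  xB : ∀ d i, ∀ v ∈ B d, x i v ∈ B (d+1)

variable {x y : Fin n → N →ₗ[K] N} {A B C : ℤ → Submodule K N} {f g : N →ₗ[K] N}

lemma SES.lift (S : SES x y A B C f g) {d : ℤ} {j : ℕ} {ω : Finset (Fin n) → N}
    (h : ω ∈ Ch (B d) j) (hg : pw g ω = 0) : ∃ ω' ∈ Ch (A d) j, pw f ω' = ω := by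
  have : ∀ T, ∃ u ∈ A d, f u = ω T := fun T => S.ker d _ (h T).1 (congrFun hg T)
  choose u hu hfu using this
  refine ⟨u, fun T => ⟨hu T, fun hT => S.finj ?_⟩, funext hfu⟩
  rw [hfu, (h T).2 hT, map_zero]

lemma SES.kdB (S : SES x y A B C f g) {d : ℤ} {j : ℕ} {ω : Finset (Fin n) → N}
    (h : ω ∈ Ch (B (d-1)) (j+1)) : kd x ω ∈ Ch (B d) j := by
  refine kd_mem (A := B (d-1)) (fun i v hv => ?_) h
  have := S.xB (d-1) i v hv
  rwa [sub_add_cancel] at this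

lemma SES.gId (S : SES x y A B C f g) {d : ℤ} {j : ℕ} {ω : Finset (Fin n) → N}
    (h : ω ∈ Ch (C d) j) : pw g ω = ω := by
  ext T; exact S.gC d _ (h T).1

lemma pw_inj (hf : Function.Injective f) : Function.Injective (pw (n := n) f) := by
  intro a b h; ext T; exact hf (congrFun h T)

lemma SES.mid (S : SES x y A B C f g) {d : ℤ} {j : ℕ} (hC : Ex y C d j) (hA : Ex x A d j) :
    Ex x B d j := by
  intro ω hω hc
  obtain ⟨η, hη, e⟩ := hC (pw g ω) (pw_mem (S.gB d) hω) (by rw [kd_pw x y g S.gx, hc, map_zero])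
  have hηB : η ∈ Ch (B (d-1)) (j+1) := Ch_mono (S.CB _) hη
  obtain ⟨ω', hω', e'⟩ := S.lift (Submodule.sub_mem _ hω (S.kdB hηB))
    (by rw [map_sub, ← kd_pw x y g S.gx, S.gId hη, e, sub_self])
  obtain ⟨η', hη', e''⟩ := hA ω' hω' (by
    apply pw_inj S.finj
    rw [← kd_pw x x f S.fx, e', map_sub, hc, kd_kd x S.xcomm, sub_self, map_zero])
  refine ⟨η + pw f η', Submodule.add_mem _ hηB (pw_mem (S.fA _) hη'), ?_⟩
  rw [map_add, kd_pw x x f S.fx, e'', e']; abel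

lemma SES.inj (S : SES x y A B C f g) {d : ℤ} {j : ℕ} (hC : Ex y C (d-1) (j+1))
    {ω β : Finset (Fin n) → N} (hβ : β ∈ Ch (B (d-1)) (j+1)) (e : kd x β = pw f ω) :
    ∃ η ∈ Ch (A (d-1)) (j+1), kd x η = ω := by
  obtain ⟨γ, hγ, e1⟩ := hC (pw g β) (pw_mem (S.gB _) hβ) (by
    rw [kd_pw x y g S.gx, e]; ext T; simp [S.gf])
  have hγB : γ ∈ Ch (B (d-1-1)) (j+1+1) := Ch_mono (S.CB _) hγ
  obtain ⟨η, hη, e2⟩ := S.lift (Submodule.sub_mem _ hβ (S.kdB hγB))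
    (by rw [map_sub, ← kd_pw x y g S.gx, S.gId hγ, e1, sub_self])
  refine ⟨η, hη, pw_inj S.finj ?_⟩
  rw [← kd_pw x x f S.fx, e2, map_sub, kd_kd x S.xcomm, e, sub_zero]

lemma SES.left (S : SES x y A B C f g) {d : ℤ} {j : ℕ} (hC : Ex y C (d-1) (j+1))
    (hB : Ex x B d j) : Ex x A d j := by
  intro ω hω hc
  obtain ⟨β, hβ, e⟩ := hB (pw f ω) (pw_mem (S.fA _) hω)
    (by rw [kd_pw x x f S.fx, hc, map_zero])
  exact S.inj hC hβ e

end ses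

section mods
variable {K : Type} [Field K] {m : ℕ}

/-- indicator exponent -/
def ind (t : Finset (Fin m)) : Fin m →₀ ℕ :=
  Finsupp.equivFunOnFinite.symm (fun l => if l ∈ t then 1 else 0)

@[simp] lemma ind_apply (t : Finset (Fin m)) (l) : ind t l = if l ∈ t then 1 else 0 := rfl

/-- elementary symmetric polynomial in the variables in `I` -/
def ek (K : Type) [Field K] (I : Finset (Fin m)) (k : ℕ) : MvPolynomial (Fin m) K :=
  ∑ t ∈ I.powersetCard k, monomial (ind t) 1

lemma ek_zero (I : Finset (Fin m)) : ek K I 0 = 1 := by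
  unfold ek
  rw [Finset.powersetCard_zero, Finset.sum_singleton]
  have : ind (∅ : Finset (Fin m)) = 0 := by ext l; simp
  rw [this]; rfl

lemma ek_card (I : Finset (Fin m)) : ek K I I.card = monomial (ind I) 1 := by
  unfold ek
  rw [Finset.powersetCard_self, Finset.sum_singleton]

lemma ek_coeff {I : Finset (Fin m)} {k : ℕ} {β : Fin m →₀ ℕ} (h : coeff β (ek K I k) ≠ 0) (i : Fin m) :
    β i ≤ if i ∈ I then 1 else 0 := by
  unfold ek at h
  rw [coeff_sum] at h
  obtain ⟨t, ht, h⟩ := Finset.exists_ne_zero_of_sum_ne_zero h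
  rw [coeff_monomial] at h
  have e : ind t = β := by by_contra hne; simp [hne] at h
  rw [← e, ind_apply]
  have := (Finset.mem_powersetCard.1 ht).1
  split_ifs with h1 h2
  · rfl
  · exact absurd (this h1) h2
  · simp
  · rfl

def xI (K : Type) [Field K] (I : Finset (Fin m)) (k : Fin (m+1)) :
    MvPolynomial (Fin m) K →ₗ[K] MvPolynomial (Fin m) K :=
  LinearMap.mulLeft K (ek K I k)

lemma xI_apply (I : Finset (Fin m)) (k p) : xI K I k p = ek K I k * p := rfl

lemma xI_comm (I : Finset (Fin m)) (k l p) : xI K I k (xI K I l p) = xI K I l (xI K I k p) := by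
  simp only [xI_apply]; ring

def AM (K : Type) [Field K] (I : Finset (Fin m)) (a : Fin m → ℤ) (N d : ℤ) :
    Submodule K (MvPolynomial (Fin m) K) where
  carrier := {p | ∀ α, coeff α p ≠ 0 → N ≤ d ∧ ∀ i, (α i : ℤ) ≤ if i ∈ I then a i + d else 0}
  add_mem' := by
    intro p q hp hq α h
    by_cases h1 : coeff α p = 0
    · exact hq α (by simpa [h1] using h)
    · exact hp α h1
  zero_mem' := by intro α h; simp at h
  smul_mem' := by
    intro c p hp α h
    refine hp α fun h0 => h (by simp [h0])

lemma mem_AM {I : Finset (Fin m)} {a : Fin m → ℤ} {N d : ℤ} {p : MvPolynomial (Fin m) K} :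
    p ∈ AM K I a N d ↔
      ∀ α, coeff α p ≠ 0 → N ≤ d ∧ ∀ i, (α i : ℤ) ≤ if i ∈ I then a i + d else 0 := Iff.rfl

lemma coeff_mul_ne {p q : MvPolynomial (Fin m) K} {α} (h : coeff α (p * q) ≠ 0) :
    ∃ β γ, β + γ = α ∧ coeff β p ≠ 0 ∧ coeff γ q ≠ 0 := by
  classical
  rw [coeff_mul] at h
  obtain ⟨⟨β, γ⟩, hm, h⟩ := Finset.exists_ne_zero_of_sum_ne_zero h
  exact ⟨β, γ, HasAntidiagonal.mem_antidiagonal.1 hm, left_ne_zero_of_mul h, right_ne_zero_of_mul h⟩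

lemma AM_x (I : Finset (Fin m)) (a : Fin m → ℤ) (N d : ℤ) (k) (p) (hp : p ∈ AM K I a N d) :
    xI K I k p ∈ AM K I a N (d+1) := by
  intro α hα
  obtain ⟨β, γ, rfl, h1, h2⟩ := coeff_mul_ne hα
  have h3 := hp γ h2
  refine ⟨by omega, fun i => ?_⟩
  have h4 := ek_coeff h1 i
  have h5 := h3.2 i
  simp only [Finsupp.add_apply]
  push_cast
  split_ifs at * <;> omega

/-- setting `X i = 0` -/
def gz (K : Type) [Field K] (i : Fin m) : MvPolynomial (Fin m) K →ₐ[K] MvPolynomial (Fin m) K :=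
  aeval (fun l => if l = i then 0 else X l)

lemma gz_monomial (i : Fin m) (α : Fin m →₀ ℕ) (c : K) :
    gz K i (monomial α c) = if α i = 0 then monomial α c else 0 := by
  unfold gz
  rw [aeval_monomial]
  split_ifs with h
  · rw [monomial_eq (s := α), algebraMap_eq]
    congr 1
    refine Finsupp.prod_congr fun l hl => ?_
    have : l ≠ i := by rintro rfl; simp [h] at hl
    simp [this]
  · rw [Finsupp.prod, Finset.prod_eq_zero (i := i) (by simpa using h)]
    · simp
    · simp [h]

lemma coeff_gz (i : Fin m) (p : MvPolynomial (Fin m) K) (α) :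
    coeff α (gz K i p) = if α i = 0 then coeff α p else 0 := by
  induction p using MvPolynomial.induction_on' with
  | monomial β c =>
    rw [gz_monomial]
    by_cases h : β = α
    · subst h; split_ifs <;> simp
    · split_ifs <;> simp [coeff_monomial, h]
  | add p q hp hq => simp only [map_add, coeff_add, hp, hq]; split_ifs <;> simp

lemma gz_ek (i : Fin m) (I : Finset (Fin m)) (k : ℕ) : gz K i (ek K I k) = ek K (I.erase i) k := by
  unfold ek
  rw [map_sum]
  have hs : (I.erase i).powersetCard k ⊆ I.powersetCard k :=
    Finset.powersetCard_mono (Finset.erase_subset _ _)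
  rw [← Finset.sum_subset_zero_on_sdiff hs]
  · intro t ht
    rw [gz_monomial, if_neg]
    simp only [ind_apply]
    simp only [mem_sdiff, mem_powersetCard, not_and] at ht
    have : i ∈ t := by
      by_contra hi
      refine ht.2 ?_ ht.1.2
      intro l hl
      exact Finset.mem_erase.2 ⟨fun h => hi (h ▸ hl), ht.1.1 hl⟩
    simp [this]
  · intro t ht
    rw [gz_monomial, if_pos]
    simp only [mem_powersetCard] at ht
    have : i ∉ t := fun h => (Finset.mem_erase.1 (ht.1 h)).1 rfl
    simp [this]

def mulX (K : Type) [Field K] (i : Fin m) : MvPolynomial (Fin m) K →ₗ[K] MvPolynomial (Fin m) K :=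
  LinearMap.mulLeft K (X i)

lemma mulX_apply (i : Fin m) (p) : mulX K i p = X i * p := rfl

lemma sesAM {I : Finset (Fin m)} {i : Fin m} (hi : i ∈ I) {a a' : Fin m → ℤ} {N : ℤ}
    (h1 : a' i = a i + 1) (h2 : ∀ l ∈ I, l ≠ i → a' l = a l) (h3 : 0 ≤ a i + 1 + N) :
    SES (xI K I) (xI K (I.erase i)) (AM K I a N) (AM K I a' N) (AM K (I.erase i) a N)
      (mulX K i) (gz K i).toLinearMap where
  xcomm := xI_comm I
  fx k v := by simp only [xI_apply, mulX_apply]; ring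
  gx k v := by simp only [xI_apply, AlgHom.toLinearMap_apply, map_mul, gz_ek]
  fA d p hp α hα := by
    obtain ⟨β, γ, rfl, h4, h5⟩ := coeff_mul_ne hα
    have h6 := hp γ h5
    refine ⟨h6.1, fun l => ?_⟩
    have h7 := h6.2 l
    have h8 : Finsupp.single i 1 = β := by
      by_contra hne; simp [coeff_X, hne] at h4
    subst h8
    simp only [Finsupp.add_apply]
    push_cast
    by_cases hl : l = i
    · subst hl; simp [hi] at h7 ⊢; omega
    · rw [Finsupp.single_apply, if_neg (Ne.symm hl)]
      split_ifs at * with hI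
      · rw [h2 l hI hl]; simpa using h7
      · simpa using h7
  gB d p hp α hα := by
    rw [AlgHom.toLinearMap_apply, coeff_gz] at hα
    have h4 : α i = 0 := by by_contra hne; simp [hne] at hα
    rw [if_pos h4] at hα
    have h5 := hp α hα
    refine ⟨h5.1, fun l => ?_⟩
    by_cases hl : l = i
    · subst hl; simp [h4]
    · have := h5.2 l
      simp only [mem_erase, hl, ne_eq, not_false_eq_true, true_and]
      split_ifs at * with hI
      · rwa [h2 l hI hl] at this
      · exact this
  finj := by
    intro p q h
    exact mul_left_cancel₀ (X_ne_zero i) h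
  gf v := by
    rw [AlgHom.toLinearMap_apply, mulX_apply, map_mul]
    simp [gz]
  CB d p hp α hα := by
    have h5 := hp α hα
    refine ⟨h5.1, fun l => ?_⟩
    have := h5.2 l
    by_cases hl : l = i
    · subst hl; simp [hi] at this ⊢; omega
    · simp only [mem_erase, hl, ne_eq, not_false_eq_true, true_and] at this
      split_ifs at * with hI
      · rwa [h2 l hI hl]
      · exact this
  gC d p hp := by
    ext α
    rw [AlgHom.toLinearMap_apply, coeff_gz]
    split_ifs with h
    · rfl
    · by_contra hne
      have := (hp α (Ne.symm hne)).2 i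
      simp at this; exact h this
  ker d p hp h0 := by
    have h4 : ∀ α, coeff α p ≠ 0 → α i ≠ 0 := by
      intro α hα h
      have := coeff_gz i p α
      rw [if_pos h] at this
      rw [← AlgHom.toLinearMap_apply, h0] at this
      exact hα (by rw [← this]; simp)
    refine ⟨p.divMonomial (Finsupp.single i 1), ?_, ?_⟩
    · intro α hα
      rw [coeff_divMonomial] at hα
      have h5 := hp _ hα
      refine ⟨h5.1, fun l => ?_⟩
      have := h5.2 l
      simp only [Finsupp.add_apply] at this
      push_cast at this
      by_cases hl : l = i
      · subst hl; simp [hi] at this ⊢; omega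
      · rw [Finsupp.single_apply, if_neg (Ne.symm hl)] at this
        split_ifs at * with hI
        · rw [h2 l hI hl] at this; simpa using this
        · simpa using this
    · have : (X i : MvPolynomial (Fin m) K) ∣ p := by
        rw [X_dvd_iff_modMonomial_eq_zero]
        ext α
        by_cases h : Finsupp.single i 1 ≤ α
        · rw [coeff_modMonomial_of_le _ h]; simp
        · rw [coeff_modMonomial_of_not_le _ h]
          by_contra hne
          apply h
          rw [Finsupp.single_le_iff]
          have := h4 α hne
          omega
      obtain ⟨q, rfl⟩ := this
      rw [mulX_apply, X_mul_divMonomial]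
  xB d k p hp := AM_x I a' N d k p hp

end mods
end SNB
end

noncomputable section
namespace SNB

section G
variable {K : Type} [Field K] {m : ℕ}

lemma AM_monoN {I : Finset (Fin m)} {a : Fin m → ℤ} {N N' d : ℤ} (h : N' ≤ N) :
    AM K I a N d ≤ AM K I a N' d := fun _ hp α hα => ⟨h.trans (hp α hα).1, (hp α hα).2⟩

lemma Ch_AM_congr {I : Finset (Fin m)} {a a' : Fin m → ℤ} (h : ∀ l ∈ I, a l = a' l)
    (N d : ℤ) : AM K I a N d = AM K I a' N d := by
  ext p
  simp only [mem_AM]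
  refine forall_congr' fun α => imp_congr_right fun _ => and_congr_right fun _ =>
    forall_congr' fun i => ?_
  split_ifs with hI
  · rw [h i hI]
  · rfl

def mulM (K : Type) [Field K] (s : Finset (Fin m)) :
    MvPolynomial (Fin m) K →ₗ[K] MvPolynomial (Fin m) K :=
  LinearMap.mulLeft K (monomial (ind s) 1)

lemma mulM_apply (s : Finset (Fin m)) (p) : mulM K s p = monomial (ind s) 1 * p := rfl

lemma mulM_insert {s : Finset (Fin m)} {i : Fin m} (h : i ∉ s) (p) :
    mulM K (insert i s) p = mulM K s (mulX K i p) := by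
  simp only [mulM_apply, mulX_apply, ← mul_assoc]
  congr 1
  have : ind (insert i s) = ind s + Finsupp.single i 1 := by
    ext l
    simp only [ind_apply, mem_insert, Finsupp.add_apply, Finsupp.single_apply]
    by_cases hl : l = i
    · subst hl; simp [h]
    · simp [hl, Ne.symm hl]
  rw [X, monomial_mul, this, mul_one]

lemma raise {I : Finset (Fin m)} (a : Fin m → ℤ) {N' d : ℤ} (σ : Fin m → ℕ)
    (hσ : Set.InjOn σ I) {j q : ℕ}
    (hN : ∀ i ∈ I, 0 ≤ a i + 1 + N')
    (hC : ∀ i ∈ I, Ex (xI K (I.erase i))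
      (AM K (I.erase i) (fun l => a l + if σ l < σ i then 1 else 0) N') (d-1) (j+1))
    (hq : ∀ i ∈ I, σ i < q) :
    ∀ u v : ℕ, u + v = q → ∀ ω β,
      β ∈ Ch (AM K I (fun l => a l + 1) N' (d-1)) (j+1) →
      kd (xI K I) β = pw (mulM K (I.filter (fun l => v ≤ σ l))) ω →
      ∃ η ∈ Ch (AM K I (fun l => a l + if σ l < v then 1 else 0) N' (d-1)) (j+1),
        kd (xI K I) η = ω := by
  intro u
  induction u with
  | zero =>
    intro v hv ω β hβ e
    have : I.filter (fun l => v ≤ σ l) = ∅ := by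
      rw [Finset.filter_eq_empty_iff]
      intro i hi
      have := hq i hi
      omega
    rw [this] at e
    refine ⟨β, ?_, ?_⟩
    · rw [Ch_AM_congr (a' := fun l => a l + 1)]
      · exact hβ
      · intro l hl
        have := hq l hl
        rw [if_pos (by omega)]
    · rw [e]; ext1 T
      have h0 : ind (∅ : Finset (Fin m)) = 0 := by ext l; simp
      simp [mulM_apply, h0]
  | succ u ih =>
    intro v hv ω β hβ e
    by_cases hex : ∃ i ∈ I, σ i = v
    · obtain ⟨i, hi, hiv⟩ := hex
      have hins : I.filter (fun l => v ≤ σ l) = insert i (I.filter (fun l => v + 1 ≤ σ l)) := by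
        ext l
        simp only [mem_filter, mem_insert]
        constructor
        · rintro ⟨h1, h2⟩
          rcases h2.eq_or_lt with h | h
          · exact Or.inl (hσ h1 hi (by omega))
          · exact Or.inr ⟨h1, h⟩
        · rintro (rfl | ⟨h1, h2⟩)
          · exact ⟨hi, hiv.ge⟩
          · exact ⟨h1, by omega⟩
      have hni : i ∉ I.filter (fun l => v + 1 ≤ σ l) := by simp; omega
      obtain ⟨η, hη, e1⟩ := ih (v+1) (by omega) (pw (mulX K i) ω) β hβ (by
        rw [e, hins]; ext1 T; simp only [pw_apply, mulM_insert hni])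
      have S : SES (xI K I) (xI K (I.erase i)) (AM K I (fun l => a l + if σ l < v then 1 else 0) N')
         (AM K I (fun l => a l + if σ l < v + 1 then 1 else 0) N')
         (AM K (I.erase i) (fun l => a l + if σ l < v then 1 else 0) N')
        (mulX K i) (gz K i).toLinearMap := by
        refine sesAM hi ?_ ?_ ?_
        · simp [hiv]
        · intro l hl hne
          have : σ l ≠ v := fun h => hne (hσ hl hi (by omega))
          try simp only
          congr 1
          split_ifs <;> omega
        · have := hN i hi
          simp [hiv]; omega
      have := hC i hi
      rw [hiv] at this
      exact S.inj this hη e1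
    · push Not at hex
      have hins : I.filter (fun l => v ≤ σ l) = I.filter (fun l => v + 1 ≤ σ l) := by
        ext l
        simp only [mem_filter]
        refine and_congr_right fun h => ?_
        have := hex l h
        omega
      obtain ⟨η, hη, e1⟩ := ih (v+1) (by omega) ω β hβ (by rw [e, hins])
      refine ⟨η, ?_, e1⟩
      rwa [Ch_AM_congr (a' := fun l => a l + if σ l < v + 1 then 1 else 0)]
      intro l hl
      have := hex l hl
      congr 1
      split_ifs <;> omega

theorem Gthm (q : ℕ) : ∀ (I : Finset (Fin m)), I.card = q → ∀ (a : Fin m → ℤ) (σ : Fin m → ℕ),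
    Set.InjOn σ I → (∀ i ∈ I, σ i < q) → ∀ (N d : ℤ) (j : ℕ),
    (∀ i ∈ I, (σ i : ℤ) ≤ a i + N) →
    (N + 1 ≤ d ∨ (N ≤ d ∧ m < j + q ∧ ∀ i ∈ I, a i + N = σ i)) →
    Ex (xI K I) (AM K I a N) d j := by
  induction q with
  | zero =>
    intro I hI a σ _ _ N d j _ hd ω hω hc
    rw [Finset.card_eq_zero] at hI
    subst hI
    have key : ∀ p, xI K (∅ : Finset (Fin m)) 0 p = p := by
      intro p; rw [xI_apply]; simp [ek_zero]
    refine ⟨wed K 0 ω, ?_, ?_⟩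
    · rcases hd with h | ⟨_, h, _⟩
      · have : ω ∈ Ch (AM K ∅ a N (d-1)) j := by
          refine Ch_mono ?_ hω
          intro p hp α hα
          exact ⟨by omega, by simpa using (hp α hα).2⟩
        exact wed_mem this 0
      · rw [Ch_eq_zero (by omega) (wed_mem hω 0)]
        exact Submodule.zero_mem _
    · have := homot_id (xI K ∅) 0 ω
      rw [hc, map_zero, add_zero] at this
      rw [this]; ext1 T; rw [pw_apply, key]
  | succ q ih =>
    intro I hI a σ hσ hlt N d j ha hd ω hω hc
    have hNd : N ≤ d := by rcases hd with h | h; omega; exact h.1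
    have hqm : q + 1 < m + 1 := by
      have := Finset.card_le_univ I
      simp at this; omega
    set k : Fin (m+1) := ⟨q+1, hqm⟩
    have hω' : ω ∈ Ch (AM K I (fun l => a l + 1) (N-1) (d-1)) j := by
      refine Ch_mono ?_ hω
      intro p hp α hα
      refine ⟨by omega, fun i => ?_⟩
      have := (hp α hα).2 i
      split_ifs at * <;> first | omega | (simp only; omega)
    obtain ⟨η, hη, e⟩ := raise (K := K) (N' := N-1) (d := d) (j := j) (q := q+1) a σ hσ
      (fun i hi => by have := ha i hi; omega)
      (by
        intro i hi
        have hne : ∀ l ∈ I.erase i, σ l ≠ σ i := fun l hl h =>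
          (Finset.mem_erase.1 hl).1 (hσ (Finset.mem_erase.1 hl).2 hi h)
        have hli : ∀ l ∈ I.erase i, l ∈ I := fun l hl => (Finset.mem_erase.1 hl).2
        have hsi := hlt i hi
        refine ih (I.erase i) (by rw [Finset.card_erase_of_mem hi]; omega) _
          (fun l => if σ l < σ i then σ l else σ l - 1) ?_ ?_ (N-1) (d-1) (j+1) ?_ ?_
        · intro l hl l' hl' h
          have h1 := hne l hl
          have h2 := hne l' hl'
          refine hσ (hli l hl) (hli l' hl') ?_
          simp only at h
          split_ifs at h <;> omega
        · intro l hl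
          have h1 := hne l hl
          have h2 := hlt l (hli l hl)
          try simp only
          split_ifs <;> omega
        · intro l hl
          have h1 := hne l hl
          have h2 := ha l (hli l hl)
          try simp only
          split_ifs <;> omega
        · rcases hd with h | ⟨h1, h2, h3⟩
          · left; omega
          · right
            refine ⟨by omega, by omega, ?_⟩
            intro l hl
            have h4 := hne l hl
            have h2 := h3 l (hli l hl)
            try simp only
            split_ifs <;> omega)
      hlt (q+1) 0 (by omega) ω (wed K k ω) (wed_mem hω' k) (by
        ext1 T
        have := homot_id (xI K I) k ω
        rw [hc, map_zero, add_zero] at this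
        rw [this, pw_apply, xI_apply, pw_apply, mulM_apply]
        congr 1
        have h3 : ((k : Fin (m+1)) : ℕ) = I.card := hI.symm
        rw [h3, ek_card]
        simp)
    have hη2 : η ∈ Ch (AM K I a (N-1) (d-1)) (j+1) := by simpa using hη
    refine ⟨η, ?_, e⟩
    rcases hd with h | ⟨_, _, h3⟩
    · refine Ch_mono ?_ hη2
      intro p hp α hα
      exact ⟨by omega, (hp α hα).2⟩
    · by_cases hd : d = N
      · subst hd
        have him : I.image σ = Finset.range (q+1) := by
          apply Finset.eq_of_subset_of_card_le
          · intro s hs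
            obtain ⟨i, hi, rfl⟩ := Finset.mem_image.1 hs
            exact Finset.mem_range.2 (hlt i hi)
          · rw [Finset.card_image_of_injOn hσ, hI]; simp
        have : 0 ∈ I.image σ := by rw [him]; simp
        obtain ⟨i, hi, h0⟩ := Finset.mem_image.1 this
        have hz : ∀ p ∈ AM K I a (d-1) (d-1), p = 0 := by
          intro p hp
          ext α
          by_contra hne
          have h4 := (hp α (by simpa using hne)).2 i
          have h5 := h3 i hi
          rw [if_pos hi] at h4
          omega
        have : η = 0 := by
          ext1 T; exact hz _ (hη2 T).1
        rw [this]; exact Submodule.zero_mem _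
      · refine Ch_mono ?_ hη2
        intro p hp α hα
        exact ⟨by omega, (hp α hα).2⟩

end G
end SNB
end

noncomputable section
namespace SNB

section T
variable {K : Type} [Field K] {n : ℕ} {N : Type} [AddCommGroup N] [Module K N]

abbrev e1 (k : Fin n) : Fin n →₀ ℕ := Finsupp.single k 1

/-- shift down -/
def sd (K : Type) [Field K] {n : ℕ} (N : Type) [AddCommGroup N] [Module K N] (k : Fin n) :
    ((Fin n →₀ ℕ) → N) →ₗ[K] ((Fin n →₀ ℕ) → N) where
  toFun ω α := ω (α + e1 k)
  map_add' _ _ := rfl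
  map_smul' _ _ := rfl

/-- shift up -/
def su (K : Type) [Field K] {n : ℕ} (N : Type) [AddCommGroup N] [Module K N] (k : Fin n) :
    ((Fin n →₀ ℕ) → N) →ₗ[K] ((Fin n →₀ ℕ) → N) where
  toFun ω α := if 1 ≤ α k then ω (α - e1 k) else 0
  map_add' a b := by ext α; by_cases h : 1 ≤ α k <;> simp [h]
  map_smul' c a := by ext α; by_cases h : 1 ≤ α k <;> simp [h]

lemma sd_apply (k : Fin n) (ω : (Fin n →₀ ℕ) → N) (α) : sd K N k ω α = ω (α + e1 k) := rfl
lemma su_apply (k : Fin n) (ω : (Fin n →₀ ℕ) → N) (α) :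
    su K N k ω α = if 1 ≤ α k then ω (α - e1 k) else 0 := rfl

lemma sd_sd (k l : Fin n) (ω : (Fin n →₀ ℕ) → N) : sd K N k (sd K N l ω) = sd K N l (sd K N k ω) := by
  ext α; simp only [sd_apply]; congr 1; abel

lemma sub_add_e1 {α : Fin n →₀ ℕ} {k : Fin n} (h : 1 ≤ α k) : α - e1 k + e1 k = α :=
  tsub_add_cancel_of_le (by rwa [Finsupp.single_le_iff])

lemma sd_su_self (k : Fin n) (ω : (Fin n →₀ ℕ) → N) : sd K N k (su K N k ω) = ω := by
  ext α; simp [sd_apply, su_apply]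

lemma su_sd_self (k : Fin n) (ω : (Fin n →₀ ℕ) → N) (α) :
    su K N k (sd K N k ω) α = if 1 ≤ α k then ω α else 0 := by
  simp only [sd_apply, su_apply]
  split_ifs with h
  · rw [sub_add_e1 h]
  · rfl

lemma su_sd_ne {k l : Fin n} (h : l ≠ k) (ω : (Fin n →₀ ℕ) → N) :
    su K N k (sd K N l ω) = sd K N l (su K N k ω) := by
  ext α
  simp only [sd_apply, su_apply]
  have h1 : (α + e1 l) k = α k := by simp [Finsupp.single_apply, h]
  rw [h1]
  split_ifs with h2
  · congr 1
    ext i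
    simp only [Finsupp.add_apply, Finsupp.tsub_apply, Finsupp.single_apply]
    by_cases hk : k = i
    · subst hk; simp [h]
    · simp [hk]
  · rfl

lemma su_su (k l : Fin n) (ω : (Fin n →₀ ℕ) → N) : su K N k (su K N l ω) = su K N l (su K N k ω) := by
  by_cases hkl : k = l
  · subst hkl; rfl
  ext α
  simp only [su_apply]
  have h1 : (α - e1 k) l = α l := by simp [Finsupp.single_apply, hkl]
  have h2 : (α - e1 l) k = α k := by simp [Finsupp.single_apply, Ne.symm hkl]
  rw [h1, h2, tsub_right_comm]
  split_ifs <;> rfl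

/-- pointwise x -/
def px (x : N →ₗ[K] N) : ((Fin n →₀ ℕ) → N) →ₗ[K] ((Fin n →₀ ℕ) → N) := x.compLeft _

@[simp] lemma px_apply (x : N →ₗ[K] N) (ω : (Fin n →₀ ℕ) → N) (α) : px x ω α = x (ω α) := rfl

def Tx (x : Fin n → N →ₗ[K] N) (k : Fin n) : ((Fin n →₀ ℕ) → N) →ₗ[K] ((Fin n →₀ ℕ) → N) :=
  sd K N k - px (x k)

lemma Tx_apply (x : Fin n → N →ₗ[K] N) (k : Fin n) (ω : (Fin n →₀ ℕ) → N) (α) :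
    Tx x k ω α = ω (α + e1 k) - x k (ω α) := rfl

lemma Tx_comm {x : Fin n → N →ₗ[K] N} (hx : ∀ i l v, x i (x l v) = x l (x i v)) (i l v) :
    Tx x i (Tx x l v) = Tx x l (Tx x i v) := by
  ext α
  simp only [Tx_apply, map_sub, hx i l]
  rw [add_right_comm]; abel

lemma kdT_apply (x : Fin n → N →ₗ[K] N) (ω : Finset (Fin n) → (Fin n →₀ ℕ) → N) (T α) :
    kd (Tx x) ω T α = kd (sd K N) ω T α - kd x (fun T => ω T α) T := by
  simp only [kd_apply, Finset.sum_apply, ← Finset.sum_sub_distrib]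
  refine Finset.sum_congr rfl fun i _ => ?_
  split_ifs
  · simp
  · simp only [Pi.smul_apply, Tx_apply, smul_sub, sd_apply]

lemma kdsd_apply (ω : Finset (Fin n) → (Fin n →₀ ℕ) → N) (T α) :
    kd (sd K N) ω T α = ∑ i, if i ∈ T then 0 else ksgn i T • ω (insert i T) (α + e1 i) := by
  simp only [kd_apply, Finset.sum_apply]
  refine Finset.sum_congr rfl fun i _ => ?_
  split_ifs
  · simp
  · rfl

lemma kdsu_apply (ω : Finset (Fin n) → (Fin n →₀ ℕ) → N) (T α) :
    kd (su K N) ω T α = ∑ i, if i ∈ T then 0 else ksgn i T •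
      (if 1 ≤ α i then ω (insert i T) (α - e1 i) else 0) := by
  simp only [kd_apply, Finset.sum_apply]
  refine Finset.sum_congr rfl fun i _ => ?_
  split_ifs with h h1
  · simp
  · simp [su_apply, h1]
  · simp [su_apply, h1]

lemma kdsd_eq_zero {ω : Finset (Fin n) → (Fin n →₀ ℕ) → N} {α} 
    (h : ∀ T, ∀ i, ω T (α + e1 i) = 0) (T) : kd (sd K N) ω T α = 0 := by
  rw [kdsd_apply]; refine Finset.sum_eq_zero fun i _ => ?_
  split_ifs <;> simp [h]

lemma deg_add_e1 (α : Fin n →₀ ℕ) (i : Fin n) : (α + e1 i).degree = α.degree + 1 := by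
  rw [map_add, Finsupp.degree_single]

lemma deg_sub_e1 {α : Fin n →₀ ℕ} {i : Fin n} (h : 1 ≤ α i) : (α - e1 i).degree + 1 = α.degree := by
  rw [← deg_add_e1 _ i, sub_add_e1 h]

/-- twisted graded pieces -/
def AT (A : ℤ → Submodule K N) (d : ℤ) : Submodule K ((Fin n →₀ ℕ) → N) where
  carrier := {ω | (∀ α, ω α ∈ A (α.degree + d)) ∧ ∃ B : ℕ, ∀ α, B ≤ α.degree → ω α = 0}
  add_mem' := by
    rintro a b ⟨ha, B, hB⟩ ⟨hb, B', hB'⟩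
    refine ⟨fun α => Submodule.add_mem _ (ha α) (hb α), max B B', fun α h => ?_⟩
    rw [Pi.add_apply, hB α (le_trans (le_max_left _ _) h),
      hB' α (le_trans (le_max_right _ _) h), add_zero]
  zero_mem' := ⟨fun α => Submodule.zero_mem _, 0, fun _ _ => rfl⟩
  smul_mem' := by
    rintro c a ⟨ha, B, hB⟩
    exact ⟨fun α => Submodule.smul_mem _ _ (ha α), B, fun α h => by simp [hB α h]⟩

lemma mem_AT {A : ℤ → Submodule K N} {d : ℤ} {ω : (Fin n →₀ ℕ) → N} :
    ω ∈ AT A d ↔ (∀ α, ω α ∈ A (α.degree + d)) ∧ ∃ B : ℕ, ∀ α, B ≤ α.degree → ω α = 0 := Iff.rfl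

lemma AT_x {A : ℤ → Submodule K N} {x : Fin n → N →ₗ[K] N} (hA : ∀ d i, ∀ v ∈ A d, x i v ∈ A (d+1))
    (d : ℤ) (i) (v) (hv : v ∈ AT A d) : Tx x i v ∈ AT A (d+1) := by
  obtain ⟨h, B, hB⟩ := hv
  refine ⟨fun α => ?_, B, fun α hα => ?_⟩
  · rw [Tx_apply]
    refine Submodule.sub_mem _ ?_ ?_
    · have := h (α + e1 i)
      rw [deg_add_e1] at this
      convert this using 2
      push_cast; ring
    · have := hA _ i _ (h α)
      rwa [add_assoc] at this
  · rw [Tx_apply, hB _ hα, hB, map_zero, sub_zero]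
    rw [deg_add_e1]; omega

lemma AT_kd {A : ℤ → Submodule K N} {x : Fin n → N →ₗ[K] N} (hA : ∀ d i, ∀ v ∈ A d, x i v ∈ A (d+1))
    {d : ℤ} {j : ℕ} {ω : Finset (Fin n) → (Fin n →₀ ℕ) → N} (h : ω ∈ Ch (AT A (d-1)) (j+1)) :
    kd (Tx x) ω ∈ Ch (AT A d) j := by
  refine kd_mem (A := AT A (d-1)) (fun i v hv => ?_) h
  have := AT_x hA (d-1) i v hv
  rwa [sub_add_cancel] at this

lemma Ch_bound {A : ℤ → Submodule K N} {d : ℤ} {j : ℕ}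
    {ω : Finset (Fin n) → (Fin n →₀ ℕ) → N} (h : ω ∈ Ch (AT A d) j) :
    ∃ B : ℕ, ∀ T α, B ≤ α.degree → ω T α = 0 := by
  choose B hB using fun T => (h T).1.2
  refine ⟨Finset.univ.sup B, fun T α hα => hB T α (le_trans (Finset.le_sup (Finset.mem_univ T)) hα)⟩

theorem Rlem {A : ℤ → Submodule K N} {x : Fin n → N →ₗ[K] N}
    (hx : ∀ i l v, x i (x l v) = x l (x i v))
    (hA : ∀ d i, ∀ v ∈ A d, x i v ∈ A (d+1)) {K0 : ℕ} {δ : ℤ} {j : ℕ}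
    (hE : ∀ k : ℕ, K0 ≤ k → Ex x A (k + δ) j) :
    ∀ η ∈ Ch (AT A δ) j, (∀ T α, K0 ≤ α.degree → kd (Tx x) η T α = 0) →
    ∃ ζ ∈ Ch (AT A (δ-1)) (j+1), ∀ T α, K0 ≤ α.degree → (η + kd (Tx x) ζ) T α = 0 := by
  suffices H : ∀ s : ℕ, ∀ η ∈ Ch (AT A δ) j, (∀ T α, K0 ≤ α.degree → kd (Tx x) η T α = 0) →
    (∀ T α, K0 + s ≤ α.degree → η T α = 0) → 
    ∃ ζ ∈ Ch (AT A (δ-1)) (j+1), ∀ T α, K0 ≤ α.degree → (η + kd (Tx x) ζ) T α = 0 by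
    intro η hη h
    obtain ⟨B, hB⟩ := Ch_bound hη
    exact H B η hη h fun T α hα => hB T α (by omega)
  intro s
  induction s with
  | zero =>
    intro η hη _ h
    exact ⟨0, Submodule.zero_mem _, fun T α hα => by simp [h T α (by omega)]⟩
  | succ s ih =>
    intro η hη hc hs
    have hcyc : ∀ α : Fin n →₀ ℕ, ∃ ζ : Finset (Fin n) → N, α.degree = K0 + s →
        ζ ∈ Ch (A (α.degree + (δ - 1))) (j+1) ∧ kd x ζ = fun T => η T α := by
      intro α
      by_cases hα : α.degree = K0 + s
      · obtain ⟨ζ, h1, h2⟩ := hE α.degree (by omega) (fun T => η T α)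
          (fun T => ⟨(hη T).1.1 α, fun hT => congrFun ((hη T).2 hT) α⟩) (by
            ext T
            have h1 := hc T α (by omega)
            rw [kdT_apply, kdsd_eq_zero (fun T i => hs T _ (by rw [deg_add_e1]; omega)), zero_sub,
              neg_eq_zero] at h1
            exact h1)
        refine ⟨ζ, fun _ => ⟨?_, h2⟩⟩
        rwa [← add_sub_assoc]
      · exact ⟨0, fun h => absurd h hα⟩
    choose ζ hζ using hcyc
    let ζ' : Finset (Fin n) → (Fin n →₀ ℕ) → N := fun T α => if α.degree = K0 + s then ζ α T else 0
    have hζ' : ζ' ∈ Ch (AT A (δ-1)) (j+1) := by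
      intro T
      refine ⟨⟨fun α => ?_, K0 + s + 1, fun α hα => if_neg (by omega)⟩, fun hT => ?_⟩
      · by_cases hα : α.degree = K0 + s
        · simp only [ζ', if_pos hα]
          exact ((hζ α hα).1 T).1
        · simp only [ζ', if_neg hα]; exact Submodule.zero_mem _
      · ext α
        by_cases hα : α.degree = K0 + s
        · simp only [ζ', if_pos hα]
          exact ((hζ α hα).1 T).2 hT
        · simp only [ζ', if_neg hα]; rfl
    obtain ⟨ζ2, h1, h2⟩ := ih (η + kd (Tx x) ζ') (Submodule.add_mem _ hη (AT_kd hA hζ'))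
      (by
        intro T α hα
        rw [map_add, kd_kd _ (Tx_comm hx), add_zero]
        exact hc T α hα)
      (by
        intro T α hα
        rw [Pi.add_apply, Pi.add_apply, kdT_apply,
          kdsd_eq_zero (fun T i => if_neg (by rw [deg_add_e1]; omega)), zero_sub]
        by_cases hα' : α.degree = K0 + s
        · have : (fun T => ζ' T α) = ζ α := by ext T; simp only [ζ', if_pos hα']
          rw [this, (hζ α hα').2]; simp
        · have : (fun T => ζ' T α) = 0 := by ext T; simp only [ζ', if_neg hα']; rfl
          rw [this, hs T α (by omega)]; simp)
    refine ⟨ζ' + ζ2, Submodule.add_mem _ hζ' h1, fun T α hα => ?_⟩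
    rw [map_add, ← add_assoc]; exact h2 T α hα

theorem Tc {A : ℤ → Submodule K N} {x : Fin n → N →ₗ[K] N}
    (hx : ∀ i l v, x i (x l v) = x l (x i v))
    (hA : ∀ d i, ∀ v ∈ A d, x i v ∈ A (d+1)) {δ : ℤ} {j : ℕ}
    (hE : ∀ d, δ ≤ d → Ex x A d j) : Ex (Tx x) (AT A) δ j := by
  intro ω hω hc
  obtain ⟨ζ, h1, h2⟩ := Rlem hx hA (K0 := 0) (fun k _ => hE _ (by omega)) ω hω
    (by simp [hc])
  refine ⟨-ζ, Submodule.neg_mem _ h1, ?_⟩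
  ext T α
  have := h2 T α (Nat.zero_le _)
  rw [map_neg]
  simp only [Pi.add_apply, Pi.neg_apply] at this ⊢
  rw [neg_eq_iff_add_eq_zero, add_comm, this]

/-- level pieces -/
def LV (B : Submodule K N) (k : ℤ) : Submodule K ((Fin n →₀ ℕ) → N) where
  carrier := {ω | ∀ α, ω α ∈ B ∧ ((α.degree : ℤ) ≠ k → ω α = 0)}
  add_mem' := by
    intro a b ha hb α
    exact ⟨B.add_mem (ha α).1 (hb α).1, fun h => by simp [(ha α).2 h, (hb α).2 h]⟩
  zero_mem' := by intro T; simp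
  smul_mem' := by
    intro c a ha α
    exact ⟨B.smul_mem c (ha α).1, fun h => by simp [(ha α).2 h]⟩

lemma LV_su {B : Submodule K N} {k : ℤ} (i : Fin n) (v) (hv : v ∈ LV B k) :
    su K N i v ∈ LV B (k+1) := by
  intro α
  rw [su_apply]
  split_ifs with h
  · refine ⟨(hv _).1, fun h' => (hv _).2 ?_⟩
    have := deg_sub_e1 h
    omega
  · exact ⟨B.zero_mem, fun _ => rfl⟩

lemma LV_sd {B : Submodule K N} {k : ℤ} (i : Fin n) (v) (hv : v ∈ LV B k) :
    sd K N i v ∈ LV B (k-1) := by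
  intro α
  rw [sd_apply]
  refine ⟨(hv _).1, fun h' => (hv _).2 ?_⟩
  rw [deg_add_e1]; omega

theorem sd_exact {B : Submodule K N} {k : ℤ} {j : ℕ} {ω : Finset (Fin n) → (Fin n →₀ ℕ) → N}
    (hω : ω ∈ Ch (LV B k) j) (hc : kd (sd K N) ω = 0) (hk : k ≠ 0 ∨ j ≠ n) :
    ∃ η ∈ Ch (LV B (k+1)) (j+1), kd (sd K N) η = ω := by
  have H : ∀ s : Finset (Fin n), ∃ η ∈ Ch (LV B (k+1)) (j+1), ∀ T α,
      (ω - kd (sd K N) η : Finset (Fin n) → (Fin n →₀ ℕ) → N) T α ≠ 0 → ω T α ≠ 0 ∧ ∀ i ∈ s, i ∈ T ∧ α i = 0 := by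
    intro s
    induction s using Finset.induction_on with
    | empty => exact ⟨0, Submodule.zero_mem _, fun T α h => ⟨by simpa using h, by simp⟩⟩
    | insert i s hi ih =>
      obtain ⟨η, hη, h⟩ := ih
      set ω' := ω - kd (sd K N) η with hω'
      have hc' : kd (sd K N) ω' = 0 := by rw [hω', map_sub, hc, kd_kd _ sd_sd, sub_zero]
      have hω'm : ω' ∈ Ch (LV B k) j := by
        refine Submodule.sub_mem _ hω (kd_mem (A := LV B (k+1)) (fun i v hv => ?_) hη)
        have := LV_sd i v hv
        rwa [add_sub_cancel_right] at this
      refine ⟨η + wed K i (pw (su K N i) ω'),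
        Submodule.add_mem _ hη (wed_mem (pw_mem (LV_su i) hω'm) i), fun T α hne => ?_⟩
      have h1 := congrFun (homot (sd K N) i (su K N i) (fun l hl v => su_sd_ne hl v) ω' T) α
      rw [hc', map_zero, map_zero, Pi.zero_apply, add_zero] at h1
      rw [map_add, ← sub_sub, ← hω', Pi.sub_apply, Pi.sub_apply, h1] at hne
      have h2 : i ∈ T ∧ α i = 0 ∧ ω' T α ≠ 0 := by
        split_ifs at hne with h3
        · rw [su_sd_self] at hne
          split_ifs at hne with h4
          · simp at hne
          · exact ⟨h3, by omega, by simpa using hne⟩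
        · rw [sd_su_self] at hne; simp at hne
      obtain ⟨h3, h4⟩ := h T α h2.2.2
      refine ⟨h3, fun l hl => ?_⟩
      rcases Finset.mem_insert.1 hl with rfl | hl
      · exact ⟨h2.1, h2.2.1⟩
      · exact h4 l hl
  obtain ⟨η, hη, h⟩ := H Finset.univ
  refine ⟨η, hη, ?_⟩
  ext T α
  by_contra hne
  obtain ⟨h1, h2⟩ := h T α (by
    rw [Pi.sub_apply, Pi.sub_apply]; exact sub_ne_zero.2 (Ne.symm hne))
  have hT : T = Finset.univ := by ext i; simp [(h2 i (Finset.mem_univ _)).1]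
  have hα : α = 0 := by ext i; simp [(h2 i (Finset.mem_univ _)).2]
  subst hT hα
  rcases hk with hk | hk
  · exact h1 (((hω _).1 0).2 (by simpa using hk.symm))
  · refine h1 ?_
    rw [(hω _).2 (by simpa using hk.symm)]; rfl

theorem su_exact {B : Submodule K N} {k : ℤ} {j : ℕ} {ω : Finset (Fin n) → (Fin n →₀ ℕ) → N}
    (hω : ω ∈ Ch (LV B k) j) (hc : kd (su K N) ω = 0) (hj : j ≠ 0) :
    ∃ η ∈ Ch (LV B (k-1)) (j+1), kd (su K N) η = ω := by
  have H : ∀ s : Finset (Fin n), ∃ η ∈ Ch (LV B (k-1)) (j+1), ∀ T α,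
      (ω - kd (su K N) η : Finset (Fin n) → (Fin n →₀ ℕ) → N) T α ≠ 0 → ω T α ≠ 0 ∧ ∀ i ∈ s, i ∉ T ∧ α i = 0 := by
    intro s
    induction s using Finset.induction_on with
    | empty => exact ⟨0, Submodule.zero_mem _, fun T α h => ⟨by simpa using h, by simp⟩⟩
    | insert i s hi ih =>
      obtain ⟨η, hη, h⟩ := ih
      set ω' := ω - kd (su K N) η with hω'
      have hc' : kd (su K N) ω' = 0 := by rw [hω', map_sub, hc, kd_kd _ su_su, sub_zero]
      have hω'm : ω' ∈ Ch (LV B k) j := by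
        refine Submodule.sub_mem _ hω (kd_mem (A := LV B (k-1)) (fun i v hv => ?_) hη)
        have := LV_su i v hv
        rwa [sub_add_cancel] at this
      refine ⟨η + wed K i (pw (sd K N i) ω'),
        Submodule.add_mem _ hη (wed_mem (pw_mem (LV_sd i) hω'm) i), fun T α hne => ?_⟩
      have h1 := congrFun (homot (su K N) i (sd K N i) 
        (fun l hl v => (su_sd_ne (Ne.symm hl) v).symm) ω' T) α
      rw [hc', map_zero, map_zero, Pi.zero_apply, add_zero] at h1
      rw [map_add, ← sub_sub, ← hω', Pi.sub_apply, Pi.sub_apply, h1] at hne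
      have h2 : i ∉ T ∧ α i = 0 ∧ ω' T α ≠ 0 := by
        split_ifs at hne with h3
        · rw [sd_su_self] at hne; simp at hne
        · rw [su_sd_self] at hne
          split_ifs at hne with h4
          · simp at hne
          · exact ⟨h3, by omega, by simpa using hne⟩
      obtain ⟨h3, h4⟩ := h T α h2.2.2
      refine ⟨h3, fun l hl => ?_⟩
      rcases Finset.mem_insert.1 hl with rfl | hl
      · exact ⟨h2.1, h2.2.1⟩
      · exact h4 l hl
  obtain ⟨η, hη, h⟩ := H Finset.univ
  refine ⟨η, hη, ?_⟩
  ext T α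
  by_contra hne
  obtain ⟨h1, h2⟩ := h T α (by
    rw [Pi.sub_apply, Pi.sub_apply]; exact sub_ne_zero.2 (Ne.symm hne))
  have hT : T = ∅ := by ext i; simp [(h2 i (Finset.mem_univ _)).1]
  subst hT
  refine h1 ?_
  rw [(hω _).2 (by simpa using hj.symm)]; rfl

end T
end SNB
end

noncomputable section
namespace SNB

section TSES
variable {K : Type} [Field K] {n : ℕ} {N : Type} [AddCommGroup N] [Module K N]
variable {x y : Fin n → N →ₗ[K] N} {A B C : ℤ → Submodule K N} {f g : N →ₗ[K] N}

lemma AT_px {A B : ℤ → Submodule K N} (h : ∀ d, ∀ v ∈ A d, f v ∈ B d) (d : ℤ)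
    (v : (Fin n →₀ ℕ) → N) (hv : v ∈ AT A d) : px f v ∈ AT B d := by
  obtain ⟨h1, D, hD⟩ := hv
  exact ⟨fun α => h _ _ (h1 α), D, fun α hα => by rw [px_apply, hD α hα, map_zero]⟩

lemma SES.T (S : SES x y A B C f g) : SES (Tx x) (Tx y) (AT A) (AT B) (AT C) (px f) (px g) where
  xcomm := Tx_comm S.xcomm
  fx k v := by ext α; simp only [px_apply, Tx_apply, map_sub, S.fx]
  gx k v := by ext α; simp only [px_apply, Tx_apply, map_sub, S.gx]
  fA := AT_px S.fA
  gB := AT_px S.gB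
  finj := by intro a b h; ext α; exact S.finj (congrFun h α)
  gf v := by ext α; exact S.gf _
  CB d v hv := ⟨fun α => S.CB _ (hv.1 α), hv.2⟩
  gC d v hv := by ext α; exact S.gC _ _ (hv.1 α)
  ker d v hv h0 := by
    have : ∀ α, ∃ u ∈ A (α.degree + d), f u = v α := fun α => S.ker _ _ (hv.1 α) (congrFun h0 α)
    choose u hu hfu using this
    obtain ⟨D, hD⟩ := hv.2
    refine ⟨u, ⟨hu, D, fun α hα => S.finj ?_⟩, funext hfu⟩
    rw [hfu, hD α hα, map_zero]
  xB := AT_x S.xB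

end TSES

section Main
variable {K : Type} [Field K] {m : ℕ}

def TEx (K : Type) [Field K] (I : Finset (Fin m)) (a : Fin m → ℤ) (N e : ℤ) (j : ℕ) : Prop :=
  Ex (Tx (xI K I)) (AT (AM K I a N)) (e + (m+1) - j) j

lemma base_stair (I : Finset (Fin m)) (a : Fin m → ℤ) (e : ℤ) (σ : Fin m → ℕ)
    (hσ : Set.InjOn σ I) (hlt : ∀ i ∈ I, σ i < I.card) (ha : ∀ i ∈ I, a i + (e + 1) = σ i)
    {j : ℕ} (hj : I.Nonempty ∨ j ≠ m) : TEx K I a (e+1) e j := by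
  refine Tc (xI_comm I) (AM_x I a (e+1)) fun d hd => ?_
  by_cases hd1 : d < e + 1
  · refine Ex_of_bot fun p hp => ?_
    ext α
    by_contra hne
    have := (hp α (by simpa using hne)).1
    omega
  · refine Gthm I.card I rfl a σ hσ hlt (e+1) d j (fun i hi => (ha i hi).ge) ?_
    by_cases hd2 : e + 1 + 1 ≤ d
    · exact Or.inl hd2
    · refine Or.inr ⟨by omega, ?_, ha⟩
      rcases hj with hj | hj
      · have := Finset.card_pos.2 hj
        omega
      · omega

lemma torsion {I : Finset (Fin m)} {a : Fin m → ℤ} {N e : ℤ} {j : ℕ} (h : TEx K I a N e j)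
    (he : e < N) : TEx K I a (N+1) e j := by
  intro ω hω hc
  unfold TEx at h
  set δ : ℤ := e + (m+1) - j with hδ
  have hmono : ∀ d, AT (n := m+1) (AM K I a (N+1)) d ≤ AT (AM K I a N) d := fun d v hv =>
    ⟨fun α => AM_monoN (by omega) (hv.1 α), hv.2⟩
  obtain ⟨η, hη, hηe⟩ := h ω (Ch_mono (hmono _) hω) hc
  have hAMz : ∀ M d p, d < M → p ∈ AM K I a M d → p = 0 := by
    intro M d p hd hp
    ext α
    by_contra hne
    have := (hp α (by simpa using hne)).1
    omega
  -- the level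
  set k1 : ℤ := N - δ + 1 with hk1
  let η1 : Finset (Fin (m+1)) → (Fin (m+1) →₀ ℕ) → MvPolynomial (Fin m) K :=
    fun T α => if (α.degree : ℤ) = k1 then η T α else 0
  have hη1 : η1 ∈ Ch (LV (AM K I a N N) k1) (j+1) := by
    intro T
    refine ⟨fun α => ⟨?_, fun hα => if_neg hα⟩, fun hT => ?_⟩
    · by_cases hα : (α.degree : ℤ) = k1
      · simp only [η1, if_pos hα]
        have := (hη T).1.1 α
        rwa [hα, show k1 + (δ - 1) = N by omega] at this
      · simp only [η1, if_neg hα]; exact Submodule.zero_mem _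
    · ext1 α
      simp only [η1, (hη T).2 hT]; simp
  have hcyc : kd (sd K _) η1 = 0 := by
    ext1 T; ext1 α
    by_cases hα : (α.degree : ℤ) + 1 = k1
    · have h1 : kd (sd K _) η1 T α = kd (sd K _) η T α := by
        rw [kdsd_apply, kdsd_apply]
        refine Finset.sum_congr rfl fun i _ => ?_
        have : (((α + e1 i).degree : ℕ) : ℤ) = k1 := by rw [deg_add_e1]; push_cast; exact hα
        simp only [η1, if_pos this]
      have h2 : kd (Tx (xI K I)) η T α = kd (sd K _) η T α := by
        rw [kdT_apply]
        have : (fun T => η T α) = 0 := by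
          ext1 T
          exact hAMz N _ _ (by omega) ((hη T).1.1 α)
        rw [this]; simp
      rw [h1, ← h2, hηe]
      exact hAMz (N+1) _ _ (by omega) ((hω T).1.1 α)
    · refine kdsd_eq_zero (fun T i => if_neg ?_) T
      rw [deg_add_e1]; push_cast; exact hα
  obtain ⟨ζ, hζ, hζe⟩ := sd_exact hη1 hcyc (by
    by_cases h : j + 1 = m + 1
    · left
      have : (j : ℤ) = m := by omega
      omega
    · exact Or.inr h)
  have hζT : ζ ∈ Ch (AT (AM K I a N) (δ-1-1)) (j+1+1) := by
    intro T
    refine ⟨⟨fun α => ?_, (k1 + 2).toNat, fun α hα => ((hζ T).1 α).2 (by omega)⟩, (hζ T).2⟩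
    by_cases hα : (α.degree : ℤ) = k1 + 1
    · rw [hα, show k1 + 1 + (δ-1-1) = N by omega]
      exact ((hζ T).1 α).1
    · rw [((hζ T).1 α).2 hα]; exact Submodule.zero_mem _
  have hη' : η - kd (Tx (xI K I)) ζ ∈ Ch (AT (AM K I a N) (δ-1)) (j+1) :=
    Submodule.sub_mem _ hη (AT_kd (AM_x I a N) hζT)
  refine ⟨η - kd (Tx (xI K I)) ζ, ?_, by
    rw [map_sub, hηe, kd_kd _ (Tx_comm (xI_comm I)), sub_zero]⟩
  intro T
  refine ⟨⟨fun α => ?_, (hη' T).1.2⟩, (hη' T).2⟩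
  by_cases hα : (α.degree : ℤ) = k1
  · have : (η - kd (Tx (xI K I)) ζ : Finset (Fin (m+1)) → (Fin (m+1) →₀ ℕ) → MvPolynomial (Fin m) K)
        T α = 0 := by
      rw [Pi.sub_apply, Pi.sub_apply, kdT_apply, hζe]
      have : (fun T => ζ T α) = 0 := by
        ext1 T
        exact ((hζ T).1 α).2 (by omega)
      rw [this, map_zero]
      simp only [η1, if_pos hα]; simp
    rw [this]; exact Submodule.zero_mem _
  · intro β hβ
    have := (hη' T).1.1 α β hβ
    exact ⟨by omega, this.2⟩

lemma torsion_iter {I : Finset (Fin m)} {a : Fin m → ℤ} {e : ℤ} {j : ℕ} (s : ℕ)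
    (h : TEx K I a (e+1) e j) : TEx K I a (e+1+s) e j := by
  induction s with
  | zero => simpa using h
  | succ s ih =>
    have := torsion ih (by omega)
    rwa [show e + 1 + ((s+1 : ℕ) : ℤ) = e + 1 + s + 1 by push_cast; ring]

lemma TEx_congr {I : Finset (Fin m)} {a a' : Fin m → ℤ} (h : ∀ l ∈ I, a l = a' l)
    {N e : ℤ} {j : ℕ} : TEx K I a N e j ↔ TEx K I a' N e j := by
  unfold TEx
  rw [show AM K I a N = AM K I a' N from funext fun d => Ch_AM_congr h N d]

lemma TEx_up {I : Finset (Fin m)} {i : Fin m} (hi : i ∈ I) (a : Fin m → ℤ) {e : ℤ} {j : ℕ}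
    {t : ℤ} (ht : 0 ≤ t) (hC : TEx K (I.erase i) a 0 e j) (s : ℕ)
    (h : TEx K I (Function.update a i t) 0 e j) : TEx K I (Function.update a i (t+s)) 0 e j := by
  induction s with
  | zero => simpa using h
  | succ s ih =>
    have S := (sesAM (K := K) hi (a := Function.update a i (t+s))
      (a' := Function.update a i (t+(s+1 : ℕ))) (N := 0)
      (by simp; ring) (by intro l _ hl; simp [hl]) (by simp; omega)).T
    refine S.mid ?_ ih
    refine (TEx_congr (a := a) ?_).1 hC
    intro l hl
    rw [Function.update_of_ne (Finset.mem_erase.1 hl).1]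

lemma TEx_down {I : Finset (Fin m)} {i : Fin m} (hi : i ∈ I) (a : Fin m → ℤ) {e : ℤ} {j : ℕ}
    {t : ℤ} (ht : 0 ≤ t) (hC : TEx K (I.erase i) a 0 e (j+1)) (s : ℕ)
    (h : TEx K I (Function.update a i (t+s)) 0 e j) : TEx K I (Function.update a i t) 0 e j := by
  induction s with
  | zero => simpa using h
  | succ s ih =>
    refine ih ?_
    have S := (sesAM (K := K) hi (a := Function.update a i (t+s))
      (a' := Function.update a i (t+(s+1 : ℕ))) (N := 0)
      (by simp; ring) (by intro l _ hl; simp [hl]) (by simp; omega)).T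
    refine S.left ?_ h
    have := (TEx_congr (a := a) (a' := Function.update a i (t+s)) (by
      intro l hl
      rw [Function.update_of_ne (Finset.mem_erase.1 hl).1])).1 hC
    unfold TEx at this
    rwa [show e + ((m : ℤ)+1) - ((j+1 : ℕ) : ℤ) = e + (m+1) - j - 1 by push_cast; ring] at this

theorem MainT (q : ℕ) : ∀ (I : Finset (Fin m)), I.card = q → ∀ (a : Fin m → ℤ) (e : ℤ) (j : ℕ),
    (∀ i ∈ I, 0 ≤ a i) → e ≤ -1 →
    ((∃ i ∈ I, a i + e = -1) ∨ j + (I.filter (fun i => a i + e ≤ -2)).card ≠ m) →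
    TEx K I a 0 e j := by
  induction q with
  | zero =>
    intro I hI a e j _ he h
    rw [Finset.card_eq_zero] at hI
    subst hI
    have := torsion_iter (K := K) (-1-e).toNat (base_stair (K := K) ∅ a e (fun _ => 0) (by simp) (by simp)
      (by simp) (j := j) (Or.inr (by simpa using h)))
    rwa [show e + 1 + (((-1-e).toNat : ℕ) : ℤ) = 0 by omega] at this
  | succ q ih =>
    intro I hI a e j ha he h
    -- first case
    have first : ∀ (a : Fin m → ℤ), (∀ i ∈ I, 0 ≤ a i) → (∃ i ∈ I, a i + e = -1) → ∀ j : ℕ, 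
        TEx K I a 0 e j := by
      intro a ha hex
      obtain ⟨i0, hi0, hai0⟩ := hex
      -- changing a coordinate
      have ch : ∀ i ∈ I, i ≠ i0 → ∀ b : Fin m → ℤ, (∀ l ∈ I, 0 ≤ b l) → b i0 + e = -1 → ∀ t, 0 ≤ t →
          ∀ j, TEx K I b 0 e j → TEx K I (Function.update b i t) 0 e j := by
        intro i hi hne b hb hbi0 t ht j hT
        have hC : ∀ j, TEx K (I.erase i) b 0 e j := fun j =>
          ih (I.erase i) (by rw [Finset.card_erase_of_mem hi]; omega) b e j
            (fun l hl => hb l (Finset.mem_erase.1 hl).2) he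
            (Or.inl ⟨i0, Finset.mem_erase.2 ⟨Ne.symm hne, hi0⟩, hbi0⟩)
        rcases le_total (b i) t with hle | hle
        · obtain ⟨s, hs⟩ := Int.le.dest hle
          rw [← hs]
          refine TEx_up hi b (hb i hi) (hC j) s ?_
          rwa [Function.update_eq_self]
        · obtain ⟨s, hs⟩ := Int.le.dest hle
          refine TEx_down hi b ht (hC (j+1)) s ?_
          rwa [hs, Function.update_eq_self]
      -- the staircase
      obtain ⟨σ0, hσ0⟩ : ∃ σ : Fin m → ℕ, Set.InjOn σ I ∧ (∀ i ∈ I, σ i < I.card) ∧ σ i0 = 0 := by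
        have hc : Fintype.card (I.erase i0) = Fintype.card (Fin q) := by
          simp only [Fintype.card_coe, Fintype.card_fin]
          rw [Finset.card_erase_of_mem hi0, hI]; simp
        let E := Fintype.equivOfCardEq hc
        refine ⟨fun l => if h : l ∈ I.erase i0 then (E ⟨l, h⟩ : ℕ) + 1 else 0, ?_, ?_, by simp⟩
        · intro l hl l' hl' hll
          simp only at hll
          by_cases h1 : l ∈ I.erase i0
          · by_cases h2 : l' ∈ I.erase i0
            · rw [dif_pos h1, dif_pos h2] at hll
              have h3 : E ⟨l, h1⟩ = E ⟨l', h2⟩ := Fin.ext (by omega)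
              have := E.injective h3
              simpa using this
            · rw [dif_pos h1, dif_neg h2] at hll; omega
          · by_cases h2 : l' ∈ I.erase i0
            · rw [dif_neg h1, dif_pos h2] at hll; omega
            · have h3 : l = i0 := by
                by_contra hne; exact h1 (Finset.mem_erase.2 ⟨hne, hl⟩)
              have h4 : l' = i0 := by
                by_contra hne; exact h2 (Finset.mem_erase.2 ⟨hne, hl'⟩)
              rw [h3, h4]
        · intro l hl
          simp only
          split_ifs with h1
          · have := (E ⟨l, h1⟩).2
            omega
          · omega
      obtain ⟨hσ1, hσ2, hσ3⟩ := hσ0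
      let b0 : Fin m → ℤ := fun l => -1 - e + σ0 l
      have hb0 : ∀ j, TEx K I b0 0 e j := by
        intro j
        have := torsion_iter (K := K) (-1-e).toNat (base_stair (K := K) I b0 e σ0 hσ1 hσ2
          (by intro i _; simp only [b0]; ring) (j := j) (Or.inl ⟨i0, hi0⟩))
        rwa [show e + 1 + (((-1-e).toNat : ℕ) : ℤ) = 0 by omega] at this
      have hs : ∀ s : Finset (Fin m), s ⊆ I.erase i0 → ∀ j,
          TEx K I (fun l => if l ∈ s then a l else b0 l) 0 e j := by
        intro s
        induction s using Finset.induction_on with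
        | empty => intro _ j; simpa using hb0 j
        | insert i s hi ih2 =>
          intro hsub j
          have hiI := Finset.mem_erase.1 (hsub (Finset.mem_insert_self i s))
          have := ch i hiI.2 hiI.1 (fun l => if l ∈ s then a l else b0 l)
            (by
              intro l hl
              split_ifs
              · exact ha l hl
              · simp only [b0]; omega)
            (by
              have : i0 ∉ s := fun h => 
                (Finset.mem_erase.1 (hsub (Finset.mem_insert_of_mem h))).1 rfl
              simp only [if_neg this, b0, hσ3]; push_cast; ring)
            (a i) (ha i hiI.2) j (ih2 ((Finset.subset_insert _ _).trans hsub) j)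
          refine (TEx_congr ?_).1 this
          intro l _
          by_cases hl : l = i
          · subst hl; simp
          · simp [hl]
      intro j
      refine (TEx_congr ?_).1 (hs (I.erase i0) (Finset.Subset.refl _) j)
      intro l hl
      by_cases hl0 : l = i0
      · subst hl0; simp only [mem_erase, ne_eq, not_true_eq_false, false_and, if_false, b0, hσ3]
        push_cast; omega
      · simp [hl0, hl]
    by_cases hex : ∃ i ∈ I, a i + e = -1
    · exact first a ha hex j
    · have hj := h.resolve_left hex
      push Not at hex
      obtain ⟨i, hi⟩ : I.Nonempty := by rw [← Finset.card_pos]; omega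
      have hup : TEx K I (Function.update a i (-1-e)) 0 e j := by
        refine first _ ?_ ⟨i, hi, by simp⟩ j
        intro l hl
        by_cases hli : l = i
        · subst hli; simp; omega
        · simp [hli, ha l hl]
      have hCc : (I.erase i).card = q := by rw [Finset.card_erase_of_mem hi]; omega
      have hai := hex i hi
      rcases le_total (-1-e) (a i) with hle | hle
      · obtain ⟨s, hs⟩ := Int.le.dest hle
        have := TEx_up hi a (by omega) (ih (I.erase i) hCc a e j
          (fun l hl => ha l (Finset.mem_erase.1 hl).2) he (Or.inr (by
            rw [Finset.filter_erase, Finset.erase_eq_of_notMem (by simp; omega)]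
            exact hj))) s hup
        rwa [hs, Function.update_eq_self] at this
      · obtain ⟨s, hs⟩ := Int.le.dest hle
        rw [← hs] at hup
        have := TEx_down hi a (ha i hi) (ih (I.erase i) hCc a e (j+1)
          (fun l hl => ha l (Finset.mem_erase.1 hl).2) he (Or.inr (by
            have hmem : i ∈ I.filter (fun i => a i + e ≤ -2) := by
              rw [Finset.mem_filter]; exact ⟨hi, by omega⟩
            have := Finset.card_pos.2 ⟨i, hmem⟩
            rw [Finset.filter_erase, Finset.card_erase_of_mem hmem]
            omega))) s hup
        rwa [Function.update_eq_self] at this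

end Main
end SNB
end

noncomputable section
namespace SNB

section Zs
variable {K : Type} [Field K] {n : ℕ} {N : Type} [AddCommGroup N] [Module K N]

/-- the linear strand -/
def Zm (x : Fin n → N →ₗ[K] N) (A : ℤ → Submodule K N) (j : ℕ) : Submodule K (Finset (Fin n) → N) :=
  Ch (A 0) j ⊓ LinearMap.ker (kd x)

/-- dual exactness in one spot -/
def DE (x : Fin n → N →ₗ[K] N) (A : ℤ → Submodule K N) (k : ℕ) (j : ℕ) : Prop :=
  ∀ ω : Finset (Fin n) → (Fin n →₀ ℕ) → N, (∀ α, (fun T => ω T α) ∈ Zm x A j) →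
    (∀ α, α.degree ≠ k → ∀ T, ω T α = 0) → kd (sd K N) ω = 0 →
    ∃ η : Finset (Fin n) → (Fin n →₀ ℕ) → N, (∀ α, (fun T => η T α) ∈ Zm x A (j+1)) ∧
    (∀ α, α.degree ≠ k + 1 → ∀ T, η T α = 0) ∧ kd (sd K N) η = ω

variable {x : Fin n → N →ₗ[K] N} {A : ℤ → Submodule K N}

theorem DE_of (hx : ∀ i l v, x i (x l v) = x l (x i v))
    (hA : ∀ d i, ∀ v ∈ A d, x i v ∈ A (d+1)) (hE : ∀ d, 1 ≤ d → ∀ j, Ex x A d j)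
    (hneg : ∀ d, d < 0 → ∀ v ∈ A d, v = 0) {k j : ℕ}
    (hT : Ex (Tx x) (AT A) (-(k:ℤ)) j) : DE x A k j := by
  intro ω hZ hs hc
  have hω : ω ∈ Ch (AT A (-(k:ℤ))) j := by
    intro T
    refine ⟨⟨fun α => ?_, k+1, fun α hα => hs α (by omega) T⟩, fun hT => ?_⟩
    · by_cases hα : α.degree = k
      · rw [hα, add_neg_cancel]; exact ((hZ α).1 T).1
      · rw [hs α hα]; exact Submodule.zero_mem _
    · ext α; exact ((hZ α).1 T).2 hT
  have hcT : kd (Tx x) ω = 0 := by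
    ext T α
    rw [kdT_apply, hc, show kd x (fun T => ω T α) = 0 from (hZ α).2]; simp
  obtain ⟨η, hη, hηe⟩ := hT ω hω hcT
  obtain ⟨ζ, hζ, hζe⟩ := Rlem hx hA (K0 := k+2) (fun k' hk' => hE _ (by push_cast at *; omega) (j+1)) η hη
    (by intro T α hα; rw [hηe]; exact hs α (by omega) T)
  set η' := η + kd (Tx x) ζ with hη'
  have hη'm : η' ∈ Ch (AT A (-(k:ℤ)-1)) (j+1) := Submodule.add_mem _ hη (AT_kd hA hζ)
  have hη'e : kd (Tx x) η' = ω := by rw [hη', map_add, hηe, kd_kd _ (Tx_comm hx), add_zero]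
  have hη's : ∀ α, α.degree ≠ k + 1 → ∀ T, η' T α = 0 := by
    intro α hα T
    by_cases h : k + 2 ≤ α.degree
    · exact hζe T α h
    · exact hneg _ (by omega) _ ((hη'm T).1.1 α)
  have hx0 : ∀ α, kd x (fun T => η' T α) = 0 := by
    intro α
    by_cases hα : α.degree = k + 1
    · ext T
      have h1 := congrFun (congrFun hη'e T) α
      rw [kdT_apply, kdsd_eq_zero (fun T i => hη's _ (by rw [deg_add_e1]; omega) T), zero_sub,
        hs α (by omega), neg_eq_zero] at h1
      exact h1
    · have : (fun T => η' T α) = 0 := by ext T; exact hη's α hα T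
      rw [this, map_zero]
  refine ⟨η', fun α => ⟨fun T => ⟨?_, fun hT => congrFun ((hη'm T).2 hT) α⟩, hx0 α⟩, hη's, ?_⟩
  · by_cases hα : α.degree = k + 1
    · have := (hη'm T).1.1 α
      rwa [hα, show ((k+1 : ℕ) : ℤ) + (-(k:ℤ)-1) = 0 by push_cast; ring] at this
    · simp only; rw [hη's α hα]; exact Submodule.zero_mem _
  · ext T α
    have h1 := congrFun (congrFun hη'e T) α
    rw [kdT_apply, hx0] at h1
    simpa using h1

/-- the other twisted differential -/
def Th (x : Fin n → N →ₗ[K] N) (k : Fin n) : ((Fin n →₀ ℕ) → N) →ₗ[K] ((Fin n →₀ ℕ) → N) :=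
  su K N k - px (x k)

lemma Th_apply (x : Fin n → N →ₗ[K] N) (k : Fin n) (ω : (Fin n →₀ ℕ) → N) :
    Th x k ω = su K N k ω - px (x k) ω := rfl

lemma su_px (f : N →ₗ[K] N) (k : Fin n) (ω : (Fin n →₀ ℕ) → N) :
    su K N k (px f ω) = px f (su K N k ω) := by
  ext α; simp only [su_apply, px_apply]; split_ifs <;> simp

lemma Th_comm (hx : ∀ i l v, x i (x l v) = x l (x i v)) (i l v) :
    Th x i (Th x l v) = Th x l (Th x i v) := by
  have : px (x i) (px (x l) v) = px (x l) (px (x i) v) := by ext α; simp [hx i l]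
  simp only [Th_apply, map_sub, su_px, this, su_su i l]
  abel

lemma kdTh_apply (x : Fin n → N →ₗ[K] N) (ω : Finset (Fin n) → (Fin n →₀ ℕ) → N) (T α) :
    kd (Th x) ω T α = kd (su K N) ω T α - kd x (fun T => ω T α) T := by
  simp only [kd_apply, Finset.sum_apply, ← Finset.sum_sub_distrib]
  refine Finset.sum_congr rfl fun i _ => ?_
  split_ifs
  · simp
  · simp only [Pi.smul_apply, Th_apply, smul_sub, Pi.sub_apply, px_apply]

lemma kdsu_eq_zero {ω : Finset (Fin n) → (Fin n →₀ ℕ) → N} {α} 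
    (h : ∀ T, ∀ i, 1 ≤ α i → ω T (α - e1 i) = 0) (T) : kd (su K N) ω T α = 0 := by
  rw [kdsu_apply]; refine Finset.sum_eq_zero fun i _ => ?_
  split_ifs with h1 h2
  · rfl
  · rw [h _ i h2, smul_zero]
  · simp

def AS (A : ℤ → Submodule K N) (d : ℤ) : Submodule K ((Fin n →₀ ℕ) → N) where
  carrier := {ω | ∀ α, ω α ∈ A (d - α.degree)}
  add_mem' := fun ha hb α => Submodule.add_mem _ (ha α) (hb α)
  zero_mem' := fun α => Submodule.zero_mem _
  smul_mem' := fun c _ ha α => Submodule.smul_mem _ _ (ha α)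

lemma AS_kd (hA : ∀ d i, ∀ v ∈ A d, x i v ∈ A (d+1))
    {d : ℤ} {j : ℕ} {ω : Finset (Fin n) → (Fin n →₀ ℕ) → N} (h : ω ∈ Ch (AS A (d-1)) (j+1)) :
    kd (Th x) ω ∈ Ch (AS A d) j := by
  refine kd_mem (A := AS A (d-1)) (fun i v hv α => ?_) h
  rw [Th_apply]
  refine Submodule.sub_mem _ ?_ ?_
  · rw [su_apply]
    split_ifs with h1
    · have := hv (α - e1 i)
      have h2 := deg_sub_e1 h1
      rwa [show d - 1 - ((α - e1 i).degree : ℤ) = d - α.degree by omega] at this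
    · exact Submodule.zero_mem _
  · have := hA _ i _ (hv α)
    rwa [show d - 1 - (α.degree : ℤ) + 1 = d - α.degree by ring] at this

lemma Th_exact (hx : ∀ i l v, x i (x l v) = x l (x i v))
    (hA : ∀ d i, ∀ v ∈ A d, x i v ∈ A (d+1)) {j : ℕ} (hj : j ≠ 0) (δ : ℤ) (B : ℕ) :
    ∀ ω ∈ Ch (AS A δ) j, kd (Th x) ω = 0 → (∀ T α, B ≤ α.degree → ω T α = 0) →
    ∃ η ∈ Ch (AS A (δ-1)) (j+1), kd (Th x) η = ω := by
  induction B with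
  | zero =>
    intro ω hω _ h
    refine ⟨0, Submodule.zero_mem _, ?_⟩
    rw [map_zero]; ext T α; exact (h T α (Nat.zero_le _)).symm
  | succ B ih =>
    intro ω hω hc hB
    let ω1 : Finset (Fin n) → (Fin n →₀ ℕ) → N := fun T α => if α.degree = B then ω T α else 0
    have hω1 : ω1 ∈ Ch (LV (A (δ - B)) B) j := by
      intro T
      refine ⟨fun α => ⟨?_, fun hα => if_neg (by exact_mod_cast hα)⟩, fun hT => ?_⟩
      · by_cases hα : α.degree = B
        · simp only [ω1, if_pos hα]
          have := (hω T).1 α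
          rwa [hα] at this
        · simp only [ω1, if_neg hα]; exact Submodule.zero_mem _
      · ext α; simp only [ω1, (hω T).2 hT]; simp
    have hc1 : kd (su K N) ω1 = 0 := by
      ext T α
      by_cases hα : α.degree = B + 1
      · have h1 : kd (su K N) ω1 T α = kd (su K N) ω T α := by
          rw [kdsu_apply, kdsu_apply]
          refine Finset.sum_congr rfl fun i _ => ?_
          split_ifs with h1 h2
          · rfl
          · have := deg_sub_e1 h2
            rw [show ω1 (insert i T) (α - e1 i) = ω (insert i T) (α - e1 i) from if_pos (by omega)]
          · rfl
        have h2 : kd (Th x) ω T α = kd (su K _) ω T α := by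
          rw [kdTh_apply]
          have : (fun T => ω T α) = 0 := by
            ext T; exact hB T α (by omega)
          rw [this]; simp
        rw [h1, ← h2, hc]
      · refine kdsu_eq_zero (fun T i hi => if_neg ?_) T
        have := deg_sub_e1 hi; omega
    obtain ⟨η, hη, hηe⟩ := su_exact hω1 hc1 hj
    have hηm : η ∈ Ch (AS A (δ-1)) (j+1) := by
      intro T
      refine ⟨fun α => ?_, (hη T).2⟩
      by_cases hα : (α.degree : ℤ) = B - 1
      · rw [hα, show δ - 1 - ((B:ℤ) - 1) = δ - B by ring]
        exact ((hη T).1 α).1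
      · rw [((hη T).1 α).2 hα]; exact Submodule.zero_mem _
    obtain ⟨ζ, hζ, hζe⟩ := ih (ω - kd (Th x) η) (Submodule.sub_mem _ hω (AS_kd hA hηm))
      (by rw [map_sub, hc, kd_kd _ (Th_comm hx), sub_zero])
      (by
        intro T α hα
        rw [Pi.sub_apply, Pi.sub_apply, kdTh_apply, hηe]
        have : (fun T => η T α) = 0 := by
          ext T; exact ((hη T).1 α).2 (by omega)
        rw [this, map_zero]
        by_cases hα' : α.degree = B
        · simp [ω1, hα']
        · simp [ω1, hα', hB T α (by omega)])
    refine ⟨η + ζ, Submodule.add_mem _ hηm hζ, ?_⟩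
    rw [map_add, hζe]; abel

lemma Rlem' (hx : ∀ i l v, x i (x l v) = x l (x i v))
    (hA : ∀ d i, ∀ v ∈ A d, x i v ∈ A (d+1)) (hE : ∀ d, 1 ≤ d → ∀ j, Ex x A d j)
    {δ : ℤ} {j : ℕ} {η : Finset (Fin n) → (Fin n →₀ ℕ) → N} (hη : η ∈ Ch (AS A δ) j)
    (hc : ∀ T α, (α.degree : ℤ) < δ → kd (Th x) η T α = 0) (s : ℕ) (hs : s ≤ δ) :
    ∃ ζ ∈ Ch (AS A (δ-1)) (j+1), ∀ T α, α.degree < s → (η + kd (Th x) ζ) T α = 0 := by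
  induction s with
  | zero => exact ⟨0, Submodule.zero_mem _, fun T α h => by omega⟩
  | succ s ih =>
    obtain ⟨ζ0, hζ0, hv⟩ := ih (by push_cast at hs; omega)
    set η' := η + kd (Th x) ζ0 with hη'
    have hη'm : η' ∈ Ch (AS A δ) j := Submodule.add_mem _ hη (AS_kd hA hζ0)
    have hη'e : kd (Th x) η' = kd (Th x) η := by
      rw [hη', map_add, kd_kd _ (Th_comm hx), add_zero]
    have hcyc : ∀ α : Fin n →₀ ℕ, ∃ ζ : Finset (Fin n) → N, α.degree = s →
        ζ ∈ Ch (A (δ - 1 - α.degree)) (j+1) ∧ kd x ζ = fun T => η' T α := by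
      intro α
      by_cases hα : α.degree = s
      · obtain ⟨ζ, h1, h2⟩ := hE (δ - α.degree) (by push_cast at hs; omega) j (fun T => η' T α)
          (fun T => ⟨(hη'm T).1 α, fun hT => congrFun ((hη'm T).2 hT) α⟩) (by
            ext T
            have h1 := hc T α (by push_cast at hs; omega)
            rw [← hη'e, kdTh_apply, kdsu_eq_zero (fun T i hi => hv T _ (by
              have := deg_sub_e1 hi; omega)), zero_sub,
              neg_eq_zero] at h1
            exact h1)
        refine ⟨ζ, fun _ => ⟨?_, h2⟩⟩
        rwa [show δ - 1 - (α.degree : ℤ) = δ - α.degree - 1 by ring]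
      · exact ⟨0, fun h => absurd h hα⟩
    choose ζ hζ using hcyc
    let ζ' : Finset (Fin n) → (Fin n →₀ ℕ) → N := fun T α => if α.degree = s then ζ α T else 0
    have hζ' : ζ' ∈ Ch (AS A (δ-1)) (j+1) := by
      intro T
      refine ⟨fun α => ?_, fun hT => ?_⟩
      · by_cases hα : α.degree = s
        · simp only [ζ', if_pos hα]
          exact ((hζ α hα).1 T).1
        · simp only [ζ', if_neg hα]; exact Submodule.zero_mem _
      · ext α
        by_cases hα : α.degree = s
        · simp only [ζ', if_pos hα]
          exact ((hζ α hα).1 T).2 hT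
        · simp only [ζ', if_neg hα]; rfl
    refine ⟨ζ0 + ζ', Submodule.add_mem _ hζ0 hζ', fun T α hα => ?_⟩
    rw [map_add, ← add_assoc, ← hη', Pi.add_apply, Pi.add_apply, kdTh_apply,
      kdsu_eq_zero (fun T i hi => if_neg (by have := deg_sub_e1 hi; omega)), zero_sub]
    by_cases hα' : α.degree = s
    · have : (fun T => ζ' T α) = ζ α := by ext T; simp only [ζ', if_pos hα']
      rw [this, (hζ α hα').2]; simp
    · have : (fun T => ζ' T α) = 0 := by ext T; simp only [ζ', if_neg hα']; rfl
      rw [this, hv T α (by omega)]; simp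

theorem SE_of (hx : ∀ i l v, x i (x l v) = x l (x i v))
    (hA : ∀ d i, ∀ v ∈ A d, x i v ∈ A (d+1)) (hE : ∀ d, 1 ≤ d → ∀ j, Ex x A d j)
    (hneg : ∀ d, d < 0 → ∀ v ∈ A d, v = 0) {k j : ℕ} (hj : j ≠ 0)
    (ω : Finset (Fin n) → (Fin n →₀ ℕ) → N) (hZ : ∀ α, (fun T => ω T α) ∈ Zm x A j)
    (hs : ∀ α, α.degree ≠ k → ∀ T, ω T α = 0) (hc : kd (su K N) ω = 0) :
    ∃ η : Finset (Fin n) → (Fin n →₀ ℕ) → N, (∀ α, (fun T => η T α) ∈ Zm x A (j+1)) ∧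
    (∀ α, α.degree + 1 ≠ k → ∀ T, η T α = 0) ∧ kd (su K N) η = ω := by
  have hω : ω ∈ Ch (AS A k) j := by
    intro T
    refine ⟨fun α => ?_, fun hT => ?_⟩
    · by_cases hα : α.degree = k
      · rw [hα, sub_self]; exact ((hZ α).1 T).1
      · rw [hs α hα]; exact Submodule.zero_mem _
    · ext α; exact ((hZ α).1 T).2 hT
  have hcT : kd (Th x) ω = 0 := by
    ext T α
    rw [kdTh_apply, hc, show kd x (fun T => ω T α) = 0 from (hZ α).2]; simp
  obtain ⟨η, hη, hηe⟩ := Th_exact hx hA hj k (k+1) ω hω hcT (fun T α hα => hs α (by omega) T)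
  obtain ⟨ζ, hζ, hζe⟩ : ∃ ζ ∈ Ch (AS A ((k:ℤ)-1-1)) (j+1+1), ∀ T α, α.degree + 1 < k →
      (η + kd (Th x) ζ) T α = 0 := by
    rcases Nat.eq_zero_or_pos k with h0 | h0
    · exact ⟨0, Submodule.zero_mem _, fun T α h => by omega⟩
    · obtain ⟨ζ, h1, h2⟩ := Rlem' hx hA hE hη (by
        intro T α hα; rw [hηe]; exact hs α (by omega) T) (k-1) (by omega)
      exact ⟨ζ, h1, fun T α hα => h2 T α (by omega)⟩
  set η' := η + kd (Th x) ζ with hη'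
  have hη'm : η' ∈ Ch (AS A ((k:ℤ)-1)) (j+1) := Submodule.add_mem _ hη (AS_kd hA hζ)
  have hη'e : kd (Th x) η' = ω := by rw [hη', map_add, hηe, kd_kd _ (Th_comm hx), add_zero]
  have hη's : ∀ α, α.degree + 1 ≠ k → ∀ T, η' T α = 0 := by
    intro α hα T
    by_cases h : α.degree + 1 < k
    · exact hζe T α h
    · exact hneg _ (by omega) _ ((hη'm T).1 α)
  have hx0 : ∀ α, kd x (fun T => η' T α) = 0 := by
    intro α
    by_cases hα : α.degree + 1 = k
    · ext T
      have h1 := congrFun (congrFun hη'e T) α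
      rw [kdTh_apply, kdsu_eq_zero (fun T i hi => hη's _ (by
          have := deg_sub_e1 hi; omega) T), zero_sub,
        hs α (by omega), neg_eq_zero] at h1
      exact h1
    · have : (fun T => η' T α) = 0 := by ext T; exact hη's α hα T
      rw [this, map_zero]
  refine ⟨η', fun α => ⟨fun T => ⟨?_, fun hT => congrFun ((hη'm T).2 hT) α⟩, hx0 α⟩, hη's, ?_⟩
  · by_cases hα : α.degree + 1 = k
    · have := (hη'm T).1 α
      rwa [show (k:ℤ) - 1 - α.degree = 0 by omega] at this
    · simp only; rw [hη's α hα]; exact Submodule.zero_mem _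
  · ext T α
    have h1 := congrFun (congrFun hη'e T) α
    rw [kdTh_apply, hx0] at h1
    simpa using h1

end Zs
end SNB
end

noncomputable section
namespace SNB

/-- linear data -/
structure LD (K : Type) [Field K] (n : ℕ) (V : Type) [AddCommGroup V] [Module K V] where
  c : Fin n → V →ₗ[K] V
  Z : ℕ → Submodule K V
  fin : ∀ j, FiniteDimensional K (Z j)
  hc : ∀ i j, ∀ v ∈ Z (j+1), c i v ∈ Z j
  hc0 : ∀ i, ∀ v ∈ Z 0, c i v = 0
  anti : ∀ i l v, c i (c l v) = - c l (c i v)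
  sq : ∀ i v, c i (c i v) = 0

section ld
variable {K : Type} [Field K] {n : ℕ} {V : Type} [AddCommGroup V] [Module K V]

def LD.Dn (D : LD K n V) : ((Fin n →₀ ℕ) → V) →ₗ[K] ((Fin n →₀ ℕ) → V) :=
  ∑ i, px (D.c i) ∘ₗ sd K V i
def LD.Up (D : LD K n V) : ((Fin n →₀ ℕ) → V) →ₗ[K] ((Fin n →₀ ℕ) → V) :=
  ∑ i, px (D.c i) ∘ₗ su K V i

lemma LD.Dn_apply (D : LD K n V) (w α) : D.Dn w α = ∑ i, D.c i (w (α + e1 i)) := by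
  simp [LD.Dn, LinearMap.sum_apply, Finset.sum_apply, sd_apply]

lemma LD.Up_apply (D : LD K n V) (w α) :
    D.Up w α = ∑ i, if 1 ≤ α i then D.c i (w (α - e1 i)) else 0 := by
  simp only [LD.Up, LinearMap.sum_apply, Finset.sum_apply, LinearMap.comp_apply, px_apply, su_apply]
  refine Finset.sum_congr rfl fun i _ => ?_
  split_ifs <;> simp

def LD.SE (D : LD K n V) : Prop := ∀ (k : ℤ) (j : ℕ), ∀ w ∈ LV (D.Z (j+1)) k, D.Up w = 0 →
  ∃ u ∈ LV (D.Z (j+2)) (k-1), D.Up u = w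

def LD.DEx (D : LD K n V) (k : ℤ) (j : ℕ) : Prop := ∀ w ∈ LV (D.Z j) k, D.Dn w = 0 →
  ∃ u ∈ LV (D.Z (j+1)) (k+1), D.Dn u = w

lemma LV_neg {B : Submodule K V} {k : ℤ} (hk : k < 0) {w : (Fin n →₀ ℕ) → V} (h : w ∈ LV B k) :
    w = 0 := by
  ext α; exact (h α).2 (by omega)

end ld

section kos
variable {K : Type} [Field K] {n : ℕ} {N : Type} [AddCommGroup N] [Module K N]
variable (x : Fin n → N →ₗ[K] N) (A : ℤ → Submodule K N)

lemma Zm_fin [FiniteDimensional K (A 0)] (j : ℕ) : FiniteDimensional K (Zm x A j) := by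
  let f : Zm x A j →ₗ[K] (Finset (Fin n) → A 0) :=
    LinearMap.pi fun T => LinearMap.codRestrict (A 0) (LinearMap.proj T ∘ₗ (Zm x A j).subtype)
      (fun ω => (ω.2.1 T).1)
  refine FiniteDimensional.of_injective f ?_
  intro a b h
  ext T
  exact congrArg Subtype.val (congrFun h T)

lemma kd_con_anti (i : Fin n) (ω : Finset (Fin n) → N) :
    kd x (con K i ω) = - con K i (kd x ω) := by
  rw [kd_eq, kd_eq, map_sum, ← Finset.sum_neg_distrib]
  refine Finset.sum_congr rfl fun l _ => ?_
  rw [← con_pw, con_con]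

def kLD (h : FiniteDimensional K (A 0)) : LD K n (Finset (Fin n) → N) where
  c i := con K i
  Z := Zm x A
  fin := Zm_fin x A
  hc i j ω hω := ⟨con_mem hω.1 i, by
    have : kd x ω = 0 := hω.2
    show kd x (con K i ω) = 0
    rw [kd_con_anti, this, map_zero, neg_zero]⟩
  hc0 i ω hω := con_zero_of_mem hω.1 i
  anti := con_con
  sq := con_con_self

lemma kLD_Dn (h : FiniteDimensional K (A 0)) (w : (Fin n →₀ ℕ) → Finset (Fin n) → N) (T α) :
    (kLD x A h).Dn w α T = kd (sd K N) (fun T α => w α T) T α := by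
  rw [LD.Dn_apply, kdsd_apply, Finset.sum_apply]
  rfl

lemma kLD_Up (h : FiniteDimensional K (A 0)) (w : (Fin n →₀ ℕ) → Finset (Fin n) → N) (T α) :
    (kLD x A h).Up w α T = kd (su K N) (fun T α => w α T) T α := by
  rw [LD.Up_apply, kdsu_apply, Finset.sum_apply]
  refine Finset.sum_congr rfl fun i _ => ?_
  split_ifs with h1 h2 h2
  · change con K i _ T = _; rw [con_apply, if_pos h2]
  · change con K i _ T = _; rw [con_apply, if_neg h2]
  · rfl
  · simp

variable {x A}

lemma kLD_DEx (h : FiniteDimensional K (A 0)) {k j : ℕ} (hD : DE x A k j) :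
    (kLD x A h).DEx k j := by
  intro w hw hc
  obtain ⟨η, h1, h2, h3⟩ := hD (fun T α => w α T) (fun α => (hw α).1)
    (fun α hα T => by rw [(hw α).2 (by exact_mod_cast hα)]; rfl) (by
      ext T α; rw [← kLD_Dn x A h, hc]; rfl)
  refine ⟨fun α T => η T α, fun α => ⟨h1 α, fun hα => ?_⟩, ?_⟩
  · ext T; exact h2 α (by exact_mod_cast hα) T
  · ext α T; rw [kLD_Dn x A h]; exact congrFun (congrFun h3 T) α

lemma kLD_SE (h : FiniteDimensional K (A 0)) (hx : ∀ i l v, x i (x l v) = x l (x i v))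
    (hA : ∀ d i, ∀ v ∈ A d, x i v ∈ A (d+1)) (hE : ∀ d, 1 ≤ d → ∀ j, Ex x A d j)
    (hneg : ∀ d, d < 0 → ∀ v ∈ A d, v = 0) : (kLD x A h).SE := by
  intro k j w hw hc
  by_cases hk : k < 0
  · refine ⟨0, Submodule.zero_mem _, ?_⟩
    rw [map_zero, LV_neg hk hw]
  obtain ⟨k, rfl⟩ := Int.eq_ofNat_of_zero_le (not_lt.1 hk)
  obtain ⟨η, h1, h2, h3⟩ := SE_of hx hA hE hneg (j := j+1) (k := k) (by omega)
    (fun T α => w α T) (fun α => (hw α).1)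
    (fun α hα T => by rw [(hw α).2 (by exact_mod_cast hα)]; rfl) (by
      ext T α; rw [← kLD_Up x A h, hc]; rfl)
  refine ⟨fun α T => η T α, fun α => ⟨h1 α, fun hα => ?_⟩, ?_⟩
  · ext T; exact h2 α (by omega) T
  · ext α T; rw [kLD_Up x A h]; exact congrFun (congrFun h3 T) α

end kos

section concrete
variable {K : Type} [Field K] {m : ℕ}

lemma AM_fin (I : Finset (Fin m)) (a : Fin m → ℤ) (N d : ℤ) :
    FiniteDimensional K (AM K I a N d) := by
  let β : Fin m →₀ ℕ := Finsupp.equivFunOnFinite.symm fun i => (a i + d).toNat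
  let S : Set (MvPolynomial (Fin m) K) := (fun α => monomial α (1:K)) '' Set.Iic β
  have hS : S.Finite := (Set.finite_Iic β).image _
  have : FiniteDimensional K (Submodule.span K S) := FiniteDimensional.span_of_finite K hS
  refine Submodule.finiteDimensional_of_le (S₂ := Submodule.span K S) ?_
  intro p hp
  rw [p.as_sum]
  refine Submodule.sum_mem _ fun α hα => ?_
  have h1 := (hp α (mem_support_iff.1 hα)).2
  have : monomial α (coeff α p) = coeff α p • monomial α (1:K) := by
    rw [smul_monomial, smul_eq_mul, mul_one]
  rw [this]
  refine Submodule.smul_mem _ _ (Submodule.subset_span ⟨α, ?_, rfl⟩)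
  intro i
  have := h1 i
  simp only [β, Finsupp.equivFunOnFinite_symm_apply_apply]
  split_ifs at this <;> omega

/-- our linear complex -/
def bD (K : Type) [Field K] (a : Fin m → ℤ) : LD K (m+1) (Finset (Fin (m+1)) → MvPolynomial (Fin m) K) :=
  kLD (xI K univ) (AM K univ a 0) (AM_fin _ _ _ _)

variable {a : Fin m → ℤ}

lemma AM_neg (a : Fin m → ℤ) (d : ℤ) (hd : d < 0) (v) (hv : v ∈ AM K univ a 0 d) : v = 0 := by
  ext α
  by_contra hne
  have := (hv α (by simpa using hne)).1
  omega

lemma AM_Ex (ha : ∀ i, (m : ℤ) ≤ a i) (d : ℤ) (hd : 1 ≤ d) (j : ℕ) :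
    Ex (xI K univ) (AM K univ a 0) d j := by
  refine Gthm m univ (by simp) a (fun i => i) (fun i _ l _ h => Fin.ext h) (fun i _ => i.2) 0 d j
    (fun i _ => ?_) (Or.inl (by omega))
  have := ha i
  have := i.2
  omega

theorem bD_SE (ha : ∀ i, (m : ℤ) ≤ a i) : (bD K a).SE :=
  kLD_SE _ (xI_comm _) (AM_x _ a 0) (AM_Ex ha) (AM_neg a)

theorem bD_DEx (ha : ∀ i, (m : ℤ) ≤ a i) (k : ℤ) (j : ℕ)
    (h : k < 0 ∨ m < j ∨ (((j : ℤ) - (m+1) - k ≤ -1) ∧ ((∃ i, a i + ((j : ℤ) - (m+1) - k) = -1) ∨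
      j + (univ.filter (fun i => a i + ((j : ℤ) - (m+1) - k) ≤ -2)).card ≠ m))) (hZ : ∀ j, m < j → (bD K a).Z j = ⊥) :
    (bD K a).DEx k j := by
  by_cases hk : k < 0
  · intro w hw _
    refine ⟨0, Submodule.zero_mem _, ?_⟩
    rw [map_zero, LV_neg hk hw]
  by_cases hj : m < j
  · intro w hw _
    refine ⟨0, Submodule.zero_mem _, ?_⟩
    rw [map_zero]; ext1 α
    have := (hw α).1
    rw [hZ j hj, Submodule.mem_bot] at this
    rw [this]; rfl
  obtain ⟨h1, h2⟩ := (h.resolve_left hk).resolve_left hj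
  obtain ⟨k, rfl⟩ := Int.eq_ofNat_of_zero_le (not_lt.1 hk)
  refine kLD_DEx _ (DE_of (xI_comm _) (AM_x _ a 0) (AM_Ex ha) (AM_neg a) ?_)
  have := MainT (K := K) m univ (by simp) a ((j:ℤ) - (m+1) - k) j (fun i _ => by have := ha i; omega)
    h1 (by simpa using h2)
  unfold TEx at this
  rwa [show (j:ℤ) - (m+1) - k + (m+1) - j = -k by ring] at this

lemma xI_zero (I : Finset (Fin m)) (p) : xI K I 0 p = p := by
  rw [xI_apply]; simp [ek_zero]

theorem bD_Z_bot (j : ℕ) (hj : m < j) : (bD K a).Z j = ⊥ := by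
  rw [eq_bot_iff]
  rintro ω ⟨h1, h2⟩
  rw [Submodule.mem_bot]
  have h2 : kd (xI K univ) ω = 0 := h2
  have := homot_id (xI K univ) 0 ω
  rw [h2, map_zero, Ch_eq_zero (by omega) (wed_mem h1 0), map_zero, add_zero] at this
  ext1 T
  have h3 := congrFun this T
  rw [pw_apply, xI_zero] at h3
  exact h3.symm

theorem bD_Zm_ne (ha : ∀ i, 1 ≤ a i) : (bD K a).Z m ≠ ⊥ := by
  intro hbot
  let p : Finset (Fin (m+1)) → MvPolynomial (Fin m) K := fun T => if T = univ then 1 else 0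
  have hp : p ∈ Ch (⊤ : Submodule K (MvPolynomial (Fin m) K)) (m+1) := by
    intro T
    refine ⟨trivial, fun hT => if_neg ?_⟩
    rintro rfl; simp at hT
  have hm : kd (xI K univ) p ∈ (bD K a).Z m := by
    refine ⟨fun T => ⟨?_, ((kd_mem (B := ⊤) (by simp) hp) T).2⟩, ?_⟩
    · rw [kd_apply]
      refine Submodule.sum_mem _ fun i _ => ?_
      split_ifs
      · exact Submodule.zero_mem _
      · refine zsmul_mem' ?_ _
        simp only [p]
        split_ifs
        · rw [xI_apply, mul_one]
          intro α hα
          refine ⟨le_refl _, fun l => ?_⟩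
          have h1 := ek_coeff hα l
          have h2 := ha l
          simp at h1 ⊢; omega
        · rw [map_zero]; exact Submodule.zero_mem _
    · exact kd_kd _ (xI_comm _) _
  rw [hbot, Submodule.mem_bot] at hm
  have h1 := congrFun hm (univ.erase 0)
  rw [kd_apply, Finset.sum_eq_single 0] at h1
  · simp only [mem_erase, ne_eq, not_true_eq_false, false_and, if_false, xI_zero, mem_univ, insert_erase, p,
      if_true] at h1
    have h2 := congrArg (fun q => ksgn (0 : Fin (m+1)) (univ.erase 0) • q) h1
    simp only [← mul_smul, ksgn_sq, one_smul, Pi.zero_apply, smul_zero] at h2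
    exact one_ne_zero h2
  · intro i _ hi
    rw [if_pos (by simp [hi])]
  · simp

end concrete
end SNB
end

noncomputable section
namespace SNB

section lin
variable {K : Type} [Field K] {n : ℕ}

/-- matrix of linear forms -/
def lin {r s : ℕ} (M : Fin n → Matrix (Fin r) (Fin s) K) : Matrix (Fin r) (Fin s) (PolyS K n) :=
  Matrix.of fun p q => ∑ i, C (M i p q) * X i

lemma lin_transpose {r s : ℕ} (M : Fin n → Matrix (Fin r) (Fin s) K) :
    (lin M).transpose = lin (fun i => (M i).transpose) := rfl

/-- coefficients of a vector of polynomials -/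
def cf {r : ℕ} (v : Fin r → PolyS K n) (α : Fin n →₀ ℕ) : Fin r → K := fun q => coeff α (v q)

lemma cf_ext {r : ℕ} {v w : Fin r → PolyS K n} (h : ∀ α, cf v α = cf w α) : v = w := by
  funext q; ext α; exact congrFun (h α) q

@[simp] lemma cf_zero {r : ℕ} (α) : cf (0 : Fin r → PolyS K n) α = 0 := by
  funext q; simp [cf]

lemma cf_lin {r s : ℕ} (M : Fin n → Matrix (Fin r) (Fin s) K) (v : Fin s → PolyS K n) (α) :
    cf ((lin M).mulVec v) α = ∑ i, if 1 ≤ α i then (M i).mulVec (cf v (α - e1 i)) else 0 := by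
  funext p
  rw [Finset.sum_apply]
  simp only [cf, Matrix.mulVec, dotProduct, lin, Matrix.of_apply, coeff_sum, Finset.sum_mul]
  rw [Finset.sum_comm]
  refine Finset.sum_congr rfl fun i _ => ?_
  have : ∀ q, coeff α (C (M i p q) * X i * v q) =
      if 1 ≤ α i then M i p q * coeff (α - e1 i) (v q) else 0 := by
    intro q
    rw [mul_assoc, mul_comm (X i), coeff_C_mul, coeff_mul_X']
    have : i ∈ α.support ↔ 1 ≤ α i := by rw [Finsupp.mem_support_iff]; omega
    rw [if_congr this rfl rfl]
    split_ifs <;> simp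
  rw [Finset.sum_congr rfl fun q _ => this q]
  by_cases h : 1 ≤ α i
  · simp only [if_pos h]; rfl
  · simp only [if_neg h, Finset.sum_const_zero]; rfl

/-- homogeneous of degree `k` -/
def Hom {r : ℕ} (v : Fin r → PolyS K n) (k : ℕ) : Prop := ∀ α, α.degree ≠ k → cf v α = 0

lemma mem_anti {k : ℕ} {α : Fin n →₀ ℕ} : α ∈ finsuppAntidiag univ k ↔ α.degree = k := by
  rw [mem_finsuppAntidiag, Finsupp.degree_eq_sum]; simp

lemma exists_cf {r : ℕ} (w : (Fin n →₀ ℕ) → Fin r → K) (k : ℕ) (hw : ∀ α, α.degree ≠ k → w α = 0) :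
    ∃ v : Fin r → PolyS K n, ∀ α, cf v α = w α := by
  refine ⟨fun q => ∑ α ∈ finsuppAntidiag univ k, monomial α (w α q), fun α => ?_⟩
  funext q
  simp only [cf, coeff_sum, coeff_monomial, Finset.sum_ite_eq', mem_anti]
  split_ifs with h
  · rfl
  · rw [hw α h]; rfl

lemma deg_sub_e1' {α : Fin n →₀ ℕ} {k : Fin n} (h : 1 ≤ α k) : (α - e1 k).degree + 1 = α.degree := by
  conv_rhs => rw [← sub_add_e1 h]
  simp

/-- homogeneous component of a vector -/
def hcomp {r : ℕ} (k : ℕ) (v : Fin r → PolyS K n) : Fin r → PolyS K n :=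
  fun q => homogeneousComponent k (v q)

lemma cf_hcomp {r : ℕ} (k : ℕ) (v : Fin r → PolyS K n) (α) :
    cf (hcomp k v) α = if α.degree = k then cf v α else 0 := by
  funext q
  simp only [cf, hcomp, coeff_homogeneousComponent]
  split_ifs <;> rfl

lemma hcomp_Hom {r : ℕ} (k : ℕ) (v : Fin r → PolyS K n) : Hom (hcomp k v) k := by
  intro α h; rw [cf_hcomp, if_neg h]

lemma hcomp_sum {r : ℕ} (v : Fin r → PolyS K n) : ∃ T, v = ∑ k ∈ range T, hcomp k v := by
  refine ⟨(univ.sup fun q => (v q).totalDegree) + 1, ?_⟩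
  funext q
  rw [Finset.sum_apply]
  have h : (v q).totalDegree ≤ univ.sup fun q => (v q).totalDegree :=
    Finset.le_sup (f := fun q => (v q).totalDegree) (mem_univ q)
  conv_lhs => rw [← sum_homogeneousComponent (v q)]
  refine Finset.sum_subset (by intro x; simp; omega) ?_
  intro k _ hk
  exact homogeneousComponent_eq_zero _ _ (by simpa using hk)

lemma lin_hcomp {r s : ℕ} (M : Fin n → Matrix (Fin r) (Fin s) K) (v : Fin s → PolyS K n) (k : ℕ) :
    (lin M).mulVec (hcomp k v) = hcomp (k+1) ((lin M).mulVec v) := by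
  refine cf_ext fun α => ?_
  rw [cf_lin, cf_hcomp, cf_lin]
  split_ifs with h
  · refine Finset.sum_congr rfl fun i _ => ?_
    split_ifs with h1
    · rw [cf_hcomp, if_pos]
      have := deg_sub_e1' h1; omega
    · rfl
  · refine Finset.sum_eq_zero fun i _ => ?_
    split_ifs with h1
    · rw [cf_hcomp, if_neg, Matrix.mulVec_zero]
      have := deg_sub_e1' h1; omega
    · rfl

lemma ker_of_hom {r s : ℕ} (M : Fin n → Matrix (Fin r) (Fin s) K) (v : Fin s → PolyS K n)
    (hv : (lin M).mulVec v = 0) (R : Submodule (PolyS K n) (Fin s → PolyS K n))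
    (hR : ∀ k u, Hom u k → (lin M).mulVec u = 0 → u ∈ R) : v ∈ R := by
  obtain ⟨T, hT⟩ := hcomp_sum v
  rw [hT]
  refine Submodule.sum_mem _ fun k _ => hR k _ (hcomp_Hom k v) ?_
  rw [lin_hcomp, hv]
  refine cf_ext fun α => ?_
  rw [cf_hcomp]; simp

lemma homogZ_hom {r : ℕ} {v : Fin r → PolyS K n} {z : ℤ} (h : ∀ q, v q ∈ homogZ K n z) :
    (z < 0 ∧ v = 0) ∨ (0 ≤ z ∧ Hom v z.toNat) := by
  by_cases hz : 0 ≤ z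
  · right
    refine ⟨hz, fun α hα => ?_⟩
    funext q
    have := h q
    rw [homogZ, iSup_pos hz, mem_homogeneousSubmodule] at this
    exact this.coeff_eq_zero hα
  · left
    refine ⟨by omega, ?_⟩
    funext q
    have := h q
    rw [homogZ, iSup_neg hz, Submodule.mem_bot] at this
    exact this

lemma sum_anti_zero {V : Type} [AddCommGroup V] (g : Fin n → Fin n → V) (h : ∀ i l, g i l = - g l i)
    (h0 : ∀ i, g i i = 0) : ∑ i, ∑ l, g i l = 0 := by
  rw [← Finset.sum_product']
  refine Finset.sum_involution (fun p _ => p.swap) ?_ ?_ ?_ ?_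
  · rintro ⟨i, l⟩ _; simp [h i l]
  · rintro ⟨i, l⟩ _ hne heq
    simp only [Prod.swap_prod_mk, Prod.mk.injEq] at heq
    obtain ⟨rfl, _⟩ := heq
    exact hne (h0 _)
  · simp
  · simp

end lin

section cx
variable {K : Type} [Field K] {n : ℕ} {V : Type} [AddCommGroup V] [Module K V]

instance LD.finI (D : LD K n V) (j : ℕ) : FiniteDimensional K (D.Z j) := D.fin j

def LD.rk (D : LD K n V) (j : ℕ) : ℕ := finrank K (D.Z j)
def LD.b (D : LD K n V) (j : ℕ) : Basis (Fin (D.rk j)) K (D.Z j) := Module.finBasis K (D.Z j)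
def LD.mc (D : LD K n V) (j : ℕ) (i : Fin n) : D.Z (j+1) →ₗ[K] D.Z j :=
  (D.c i).restrict (D.hc i j)
def LD.mat (D : LD K n V) (j : ℕ) (i : Fin n) : Matrix (Fin (D.rk j)) (Fin (D.rk (j+1))) K :=
  LinearMap.toMatrix (D.b (j+1)) (D.b j) (D.mc j i)
def LD.dd (D : LD K n V) (j : ℕ) : Matrix (Fin (D.rk j)) (Fin (D.rk (j+1))) (PolyS K n) :=
  lin (D.mat j)

def LD.vec (D : LD K n V) (j : ℕ) (v : Fin (D.rk j) → PolyS K n) (α : Fin n →₀ ℕ) : V :=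
  ((D.b j).equivFun.symm (cf v α) : D.Z j)

lemma LD.vec_inj (D : LD K n V) {j : ℕ} {v w : Fin (D.rk j) → PolyS K n}
    (h : D.vec j v = D.vec j w) : v = w := by
  refine cf_ext fun α => ?_
  exact (D.b j).equivFun.symm.injective (Subtype.ext (congrFun h α))

lemma LD.vec_zero (D : LD K n V) (j : ℕ) : D.vec j 0 = 0 := by
  funext α; simp [LD.vec]

lemma LD.c_vec (D : LD K n V) (j : ℕ) (i : Fin n) (x : Fin (D.rk (j+1)) → K) :
    D.c i ((D.b (j+1)).equivFun.symm x : D.Z (j+1)) =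
      ((D.b j).equivFun.symm ((D.mat j i).mulVec x) : D.Z j) := by
  have h := LinearMap.toMatrix_mulVec_repr (D.b (j+1)) (D.b j) (D.mc j i)
    ((D.b (j+1)).equivFun.symm x)
  have h1 : ((D.b (j+1)).repr ((D.b (j+1)).equivFun.symm x) : Fin (D.rk (j+1)) → K) = x :=
    (D.b (j+1)).equivFun.apply_symm_apply x
  rw [h1] at h
  unfold LD.mat
  rw [h]
  have h2 := (D.b j).equivFun.symm_apply_apply (D.mc j i ((D.b (j+1)).equivFun.symm x))
  rw [Basis.equivFun_apply] at h2
  rw [h2]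
  rfl

lemma LD.Up_vec (D : LD K n V) (j : ℕ) (v : Fin (D.rk (j+1)) → PolyS K n) :
    D.Up (D.vec (j+1) v) = D.vec j ((D.dd j).mulVec v) := by
  funext α
  rw [LD.Up_apply]
  unfold LD.vec LD.dd
  rw [cf_lin, map_sum, AddSubmonoidClass.coe_finsetSum]
  refine Finset.sum_congr rfl fun i _ => ?_
  split_ifs with h
  · rw [D.c_vec]
  · simp

lemma LD.Up_Up (D : LD K n V) (w) : D.Up (D.Up w) = 0 := by
  have : ∀ i l, (px (D.c i)) (su K V i (px (D.c l) (su K V l w)))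
      = px (D.c i) (px (D.c l) (su K V i (su K V l w))) := by
    intro i l
    congr 1
    funext α
    simp only [px_apply, su_apply]
    split_ifs <;> simp
  simp only [LD.Up, LinearMap.sum_apply, LinearMap.comp_apply, map_sum, this]
  refine sum_anti_zero _ (fun i l => ?_) (fun i => ?_)
  · rw [su_su]
    funext α
    simp only [px_apply, Pi.neg_apply]
    rw [D.anti]
  · funext α; simp only [px_apply, D.sq]; rfl

lemma LD.dd_dd (D : LD K n V) (j : ℕ) : D.dd j * D.dd (j+1) = 0 := by
  refine Matrix.mulVec_injective ?_
  funext v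
  rw [← Matrix.mulVec_mulVec, Matrix.zero_mulVec]
  refine D.vec_inj ?_
  rw [← D.Up_vec, ← D.Up_vec, D.Up_Up, D.vec_zero]

lemma LD.vec_mem (D : LD K n V) {j k : ℕ} {v : Fin (D.rk j) → PolyS K n} (h : Hom v k) :
    D.vec j v ∈ LV (D.Z j) k := by
  intro α
  refine ⟨Subtype.mem _, fun hα => ?_⟩
  have := h α (by exact_mod_cast hα)
  simp [LD.vec, this]

lemma LD.exists_vec (D : LD K n V) {j : ℕ} (k : ℤ) {w} (h : w ∈ LV (D.Z j) k) :
    ∃ v, D.vec j v = w := by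
  obtain ⟨v, hv⟩ := exists_cf (fun α => (D.b j).equivFun ⟨w α, (h α).1⟩) k.toNat (fun α hα => by
    have : (⟨w α, (h α).1⟩ : D.Z j) = 0 := Subtype.ext ((h α).2 (by omega))
    rw [this, map_zero])
  refine ⟨v, ?_⟩
  funext α
  rw [LD.vec, hv, LinearEquiv.symm_apply_apply]

lemma LD.res (D : LD K n V) (hS : D.SE) (j : ℕ) :
    LinearMap.ker (D.dd j).mulVecLin = LinearMap.range (D.dd (j+1)).mulVecLin := by
  refine le_antisymm ?_ ?_
  · intro v hv
    refine ker_of_hom (D.mat j) v hv _ ?_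
    intro k u hu h0
    obtain ⟨w, hw, hw'⟩ := hS k j _ (D.vec_mem hu) (by
      rw [D.Up_vec, LD.dd, h0, D.vec_zero])
    obtain ⟨v', rfl⟩ := D.exists_vec _ hw
    refine ⟨v', ?_⟩
    rw [Matrix.mulVecLin_apply]
    refine D.vec_inj ?_
    rw [← D.Up_vec, hw']
  · rintro _ ⟨v, rfl⟩
    simp [Matrix.mulVec_mulVec, D.dd_dd]

/-- The free complex. -/
def LD.F (D : LD K n V) (N0 : ℤ) (m : ℕ) (hZ : ∀ j, m < j → D.Z j = ⊥) : FreeComplex K n where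
  len := m
  rk := D.rk
  deg j _ := N0 + j
  dd := D.dd
  rk_eq_zero i hi := by rw [LD.rk, hZ i hi, finrank_bot]
  isHomog i p q := by
    have : (N0 + ((i+1 : ℕ) : ℤ) - (N0 + i)) = 1 := by push_cast; ring
    rw [this, homogZ, iSup_pos (by norm_num), mem_homogeneousSubmodule]
    show (∑ l, C (D.mat i l p q) * X l : PolyS K n).IsHomogeneous 1
    refine IsHomogeneous.sum _ _ _ fun l _ => ?_
    exact (isHomogeneous_C_mul_X _ _)
  isComplex := D.dd_dd

end cx
end SNB
end

noncomputable section
namespace SNB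

section dual
variable {K : Type} [Field K] {n : ℕ} {V : Type} [AddCommGroup V] [Module K V]

lemma deg_add_e1' (α : Fin n →₀ ℕ) (i : Fin n) : (α + e1 i).degree = α.degree + 1 := by simp

lemma reidx {M : Type} [AddCommMonoid M] (k : ℕ) (i : Fin n) (f : (Fin n →₀ ℕ) → (Fin n →₀ ℕ) → M) :
    ∑ α ∈ finsuppAntidiag univ k, f α (α + e1 i) =
      ∑ β ∈ finsuppAntidiag univ (k+1), if 1 ≤ β i then f (β - e1 i) β else 0 := by
  rw [← Finset.sum_filter]
  refine Finset.sum_nbij' (fun α => α + e1 i) (fun β => β - e1 i) ?_ ?_ ?_ ?_ ?_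
  · intro α hα
    rw [mem_anti] at hα
    rw [mem_filter, mem_anti, deg_add_e1', hα]; simp
  · intro β hβ
    rw [mem_filter, mem_anti] at hβ
    rw [mem_anti]
    have := deg_sub_e1' hβ.2; omega
  · intro α _; simp
  · intro β hβ
    rw [mem_filter] at hβ
    exact sub_add_e1 hβ.2
  · intro α _; simp

/-- coefficient functional extended to V -/
lemma LD.exists_Lam (D : LD K n V) (j : ℕ) (x : Fin (D.rk j) → K) :
    ∃ g : V →ₗ[K] K, ∀ q, g (D.b j q) = x q := by
  obtain ⟨g, hg⟩ := LinearMap.exists_extend ((D.b j).constr K x)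
  refine ⟨g, fun q => ?_⟩
  have := LinearMap.congr_fun hg (D.b j q)
  rw [Basis.constr_basis] at this
  exact this

lemma LD.c_b (D : LD K n V) (j : ℕ) (i : Fin n) (p) :
    D.c i (D.b (j+1) p) = ∑ q, D.mat j i q p • (D.b j q : V) := by
  have h := D.c_vec j i (Pi.single p 1)
  have h1 : (D.b (j+1)).equivFun.symm (Pi.single p 1) = D.b (j+1) p := by
    rw [LinearEquiv.symm_apply_eq]
    funext q; rw [Basis.equivFun_self]; simp [Pi.single_apply, eq_comm]
  rw [h1] at h
  rw [h, Basis.equivFun_symm_apply, AddSubmonoidClass.coe_finsetSum]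
  simp

lemma LD.Dn_mem_zero (D : LD K n V) {k : ℤ} {w} (hw : w ∈ LV (D.Z 0) k) : D.Dn w = 0 := by
  funext α
  rw [D.Dn_apply]
  exact Finset.sum_eq_zero fun i _ => D.hc0 i _ (hw _).1

lemma LD.Dn_single (D : LD K n V) (α : Fin n →₀ ℕ) (x : V) :
    D.Dn (Pi.single α x) = ∑ i, if 1 ≤ α i then Pi.single (α - e1 i) (D.c i x) else 0 := by
  funext β
  rw [D.Dn_apply, Finset.sum_apply]
  refine Finset.sum_congr rfl fun i _ => ?_
  by_cases h : β + e1 i = α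
  · subst h
    rw [if_pos (by simp)]; simp
  · rw [Pi.single_eq_of_ne h, map_zero]
    split_ifs with h1
    · rw [Pi.single_eq_of_ne]
      rintro rfl
      exact h (sub_add_e1 h1)
    · rfl

lemma single_mem_LV {B : Submodule K V} {x : V} (hx : x ∈ B) (α : Fin n →₀ ℕ) :
    (Pi.single α x : (Fin n →₀ ℕ) → V) ∈ LV B α.degree := by
  intro β
  by_cases h : β = α
  · subst h; simp [hx]
  · simp [Pi.single_eq_of_ne h]

/-- main dual functional -/
lemma LD.exists_psi (D : LD K n V) (j k : ℕ) (hD : D.DEx k j) (v : Fin (D.rk j) → PolyS K n)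
    (h0 : (D.dd j).transpose.mulVec v = 0) :
    ∃ ψ : ((Fin n →₀ ℕ) → V) →ₗ[K] K, ∀ α, α.degree = k → ∀ q,
      ψ (D.Dn (Pi.single α (D.b j q : V))) = coeff α (v q) := by
  choose Λ hΛ using fun α => D.exists_Lam j (cf v α)
  let φ : ((Fin n →₀ ℕ) → V) →ₗ[K] K := ∑ α ∈ finsuppAntidiag univ k, Λ α ∘ₗ LinearMap.proj α
  have hφ : ∀ w, φ w = ∑ α ∈ finsuppAntidiag univ k, Λ α (w α) := by
    intro w; simp [φ, LinearMap.sum_apply]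
  have hz : ∀ β, ∀ x ∈ D.Z (j+1), ∑ i, (if 1 ≤ β i then Λ (β - e1 i) (D.c i x) else 0) = 0 := by
    intro β x hx
    let g : D.Z (j+1) →ₗ[K] K := ∑ i, if 1 ≤ β i then Λ (β - e1 i) ∘ₗ D.c i ∘ₗ (D.Z (j+1)).subtype else 0
    have hg : ∀ x, g x = ∑ i, (if 1 ≤ β i then Λ (β - e1 i) (D.c i x) else 0) := by
      intro x
      simp only [g, LinearMap.sum_apply]
      refine Finset.sum_congr rfl fun i _ => ?_
      split_ifs <;> rfl
    have : g = 0 := by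
      refine (D.b (j+1)).ext fun p => ?_
      rw [hg]
      have h1 : cf ((D.dd j).transpose.mulVec v) β p = 0 := by rw [h0]; simp
      unfold LD.dd at h1
      rw [lin_transpose, cf_lin, Finset.sum_apply] at h1
      rw [LinearMap.zero_apply]
      refine Eq.trans ?_ h1
      refine Finset.sum_congr rfl fun i _ => ?_
      split_ifs with h2
      · rw [D.c_b, map_sum]
        simp only [Matrix.mulVec, dotProduct, map_smul, hΛ, smul_eq_mul, Matrix.transpose_apply]
      · rfl
    have h2 := hg ⟨x, hx⟩
    rw [this] at h2
    exact h2.symm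
  have hk : ∀ u ∈ LV (D.Z (j+1)) ((k:ℤ)+1), φ (D.Dn u) = 0 := by
    intro u hu
    rw [hφ]
    simp only [D.Dn_apply, map_sum]
    rw [Finset.sum_comm]
    have : ∀ i, ∑ α ∈ finsuppAntidiag univ k, Λ α (D.c i (u (α + e1 i))) = _ :=
      fun i => reidx k i (fun α β => Λ α (D.c i (u β)))
    simp only [this]
    rw [Finset.sum_comm]
    exact Finset.sum_eq_zero fun β _ => hz β _ (hu β).1
  let U := LV (n := n) (D.Z j) (k:ℤ)
  have hann : φ ∘ₗ U.subtype ∈ (LinearMap.ker (D.Dn ∘ₗ U.subtype)).dualAnnihilator := by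
    rw [Submodule.mem_dualAnnihilator]
    rintro ⟨w, hw⟩ hw0
    obtain ⟨u, hu, rfl⟩ := hD w hw hw0
    exact hk u hu
  rw [← LinearMap.range_dualMap_eq_dualAnnihilator_ker] at hann
  obtain ⟨ψ, hψ⟩ := hann
  refine ⟨ψ, fun α hα q => ?_⟩
  have h1 := LinearMap.congr_fun hψ ⟨Pi.single α (D.b j q : V), by
    have := single_mem_LV (n := n) (D.b j q).2 α
    rwa [hα] at this⟩
  have h2 : ψ (D.Dn (Pi.single α (D.b j q : V))) = φ (Pi.single α (D.b j q : V)) := h1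
  rw [h2, hφ, Finset.sum_eq_single α]
  · rw [Pi.single_eq_same, hΛ]; rfl
  · intro β _ hβ; rw [Pi.single_eq_of_ne hβ, map_zero]
  · intro h; rw [mem_anti] at h; exact absurd hα h

lemma LD.dual_zero (D : LD K n V) (k : ℕ) (hD : D.DEx k 0) (v : Fin (D.rk 0) → PolyS K n)
    (hv : Hom v k) (h0 : (D.dd 0).transpose.mulVec v = 0) : v = 0 := by
  obtain ⟨ψ, hψ⟩ := D.exists_psi 0 k hD v h0
  refine cf_ext fun α => ?_
  by_cases hα : α.degree = k
  · funext q
    have := hψ α hα q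
    rw [D.Dn_mem_zero (single_mem_LV (D.b 0 q).2 α), map_zero] at this
    rw [cf, ← this]; simp
  · rw [hv α hα, cf_zero]

lemma LD.dual_succ (D : LD K n V) (k j : ℕ) (hD : D.DEx k (j+1)) (v : Fin (D.rk (j+1)) → PolyS K n)
    (hv : Hom v k) (h0 : (D.dd (j+1)).transpose.mulVec v = 0) :
    v ∈ LinearMap.range (D.dd j).transpose.mulVecLin := by
  obtain ⟨ψ, hψ⟩ := D.exists_psi (j+1) k hD v h0
  obtain ⟨u, hu⟩ := exists_cf (fun β q => if β.degree + 1 = k then ψ (Pi.single β (D.b j q : V)) else 0)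
    (k-1) (fun α hα => by funext q; rw [if_neg (by omega)]; rfl)
  refine ⟨u, ?_⟩
  rw [Matrix.mulVecLin_apply]
  refine cf_ext fun α => ?_
  unfold LD.dd
  rw [lin_transpose, cf_lin]
  by_cases hα : α.degree = k
  · funext p
    rw [Finset.sum_apply]
    have := hψ α hα p
    rw [D.Dn_single, map_sum] at this
    rw [cf, ← this]
    refine Finset.sum_congr rfl fun i _ => ?_
    split_ifs with h
    · have h1 := deg_sub_e1' h
      have h2 : (Pi.single (α - e1 i) (D.c i (D.b (j+1) p)) : (Fin n →₀ ℕ) → V) =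
          ∑ q, D.mat j i q p • Pi.single (α - e1 i) (D.b j q : V) := by
        rw [D.c_b]
        have := map_sum (LinearMap.single K (fun _ : Fin n →₀ ℕ => V) (α - e1 i))
          (fun q => D.mat j i q p • (D.b j q : V)) univ
        simp only [map_smul, LinearMap.coe_single] at this
        exact this
      rw [h2, hu, map_sum]
      simp only [Matrix.mulVec, dotProduct, map_smul, smul_eq_mul, Matrix.transpose_apply]
      simp only [show (α - e1 i).degree + 1 = k by omega, if_true]
    · simp
  · rw [hv α hα]
    refine Finset.sum_eq_zero fun i _ => ?_
    split_ifs with h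
    · have h1 := deg_sub_e1' h
      rw [hu]
      simp only [show ¬ (α - e1 i).degree + 1 = k by omega, if_false]
      exact Matrix.mulVec_zero _
    · rfl

lemma finrank_quot_zero {W : Type} [AddCommGroup W] [Module K W] (P Q : Submodule K W) (h : P ≤ Q) :
    finrank K (P ⧸ Q.comap P.subtype) = 0 := by
  have : Subsingleton (P ⧸ Q.comap P.subtype) := by
    have : Q.comap P.subtype = ⊤ := by
      rw [eq_top_iff]
      rintro ⟨x, hx⟩ _; exact h hx
    obtain ⟨u⟩ := Submodule.unique_quotient_iff_eq_top.2 this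
    infer_instance
  exact finrank_zero_of_subsingleton

lemma LD.cohom_zero (D : LD K n V) (N0 : ℤ) (m : ℕ) (hZ : ∀ j, m < j → D.Z j = ⊥) (j : ℕ) (ℓ : ℤ)
    (hD : D.DEx (ℓ + N0 + j) j) : cohomDim (dualCo (D.F N0 m hZ)) j ℓ = 0 := by
  refine finrank_quot_zero _ _ ?_
  rintro v ⟨h1, h2⟩
  have h1 : (D.dd j).transpose.mulVec v = 0 := h1
  have h2 : ∀ q, v q ∈ homogZ K n (ℓ + N0 + j) := by
    intro q
    have : v q ∈ homogZ K n (ℓ - (dualCo (D.F N0 m hZ)).deg j q) := h2 q (Set.mem_univ _)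
    have e : ℓ - (dualCo (D.F N0 m hZ)).deg j q = ℓ + N0 + j := by
      show ℓ - -(N0 + j) = _
      ring
    rwa [e] at this
  rcases homogZ_hom h2 with ⟨_, rfl⟩ | ⟨h3, h4⟩
  · exact Submodule.zero_mem _
  · rw [← Int.toNat_of_nonneg h3] at hD
    cases j with
    | zero =>
      rw [D.dual_zero _ hD v h4 h1]; exact Submodule.zero_mem _
    | succ j => exact D.dual_succ _ j hD v h4 h1

lemma LD.MPiece_zero (D : LD K n V) (N0 : ℤ) (m : ℕ) (hZ : ∀ j, m < j → D.Z j = ⊥) (d : ℤ)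
    (hd : d < N0) : MPieceDim (D.F N0 m hZ) d = 0 := by
  refine finrank_quot_zero _ _ ?_
  intro v h2
  have h2 : ∀ q, v q ∈ homogZ K n (d - N0) := by
    intro q
    have : v q ∈ homogZ K n (d - (D.F N0 m hZ).deg 0 q) := h2 q (Set.mem_univ _)
    have e : d - (D.F N0 m hZ).deg 0 q = d - N0 := by
      show d - (N0 + (0:ℕ)) = _
      simp
    rwa [e] at this
  rcases homogZ_hom h2 with ⟨_, rfl⟩ | ⟨h3, h4⟩
  · exact Submodule.zero_mem _
  · omega

end dual
end SNB
end

noncomputable section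
namespace SNB

section dims
variable {K : Type} [Field K] {n : ℕ} {V : Type} [AddCommGroup V] [Module K V]

lemma LD.Dn_Dn (D : LD K n V) (w) : D.Dn (D.Dn w) = 0 := by
  have : ∀ i l, (px (D.c i)) (sd K V i (px (D.c l) (sd K V l w)))
      = px (D.c i) (px (D.c l) (sd K V i (sd K V l w))) := by
    intro i l
    rfl
  simp only [LD.Dn, LinearMap.sum_apply, LinearMap.comp_apply, map_sum, this]
  refine sum_anti_zero _ (fun i l => ?_) (fun i => ?_)
  · rw [sd_sd]
    funext α
    simp only [px_apply, Pi.neg_apply]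
    rw [D.anti]
  · funext α; simp only [px_apply, D.sq]; rfl

lemma LD.Dn_mem (D : LD K n V) {j : ℕ} {k : ℤ} {w} (hw : w ∈ LV (D.Z (j+1)) (k+1)) :
    D.Dn w ∈ LV (D.Z j) k := by
  intro α
  rw [D.Dn_apply]
  refine ⟨Submodule.sum_mem _ fun i _ => D.hc i j _ (hw _).1, fun hα => ?_⟩
  refine Finset.sum_eq_zero fun i _ => ?_
  rw [(hw _).2, map_zero]
  rw [deg_add_e1']; push_cast; omega

def LVequiv (B : Submodule K V) (k : ℕ) :
    LV (n := n) B k ≃ₗ[K] ((finsuppAntidiag (univ : Finset (Fin n)) k) → B) where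
  toFun w α := ⟨w.1 α, (w.2 α).1⟩
  map_add' _ _ := rfl
  map_smul' _ _ := rfl
  invFun f := ⟨fun α => if h : α ∈ finsuppAntidiag univ k then f ⟨α, h⟩ else 0, fun α => by
    constructor
    · beta_reduce
      split_ifs
      · exact Subtype.mem _
      · exact Submodule.zero_mem _
    · intro hα
      beta_reduce
      rw [dif_neg]
      rw [mem_anti]; exact_mod_cast hα⟩
  left_inv w := by
    ext α
    simp only
    split_ifs with h
    · rfl
    · rw [mem_anti] at h
      rw [(w.2 α).2 (by exact_mod_cast h)]
  right_inv f := by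
    funext α
    ext
    simp

lemma LV_finite (B : Submodule K V) [FiniteDimensional K B] (k : ℤ) :
    FiniteDimensional K (LV (n := n) B k) := by
  by_cases hk : k < 0
  · have : LV (n := n) B k = ⊥ := by
      rw [eq_bot_iff]; intro w hw; rw [Submodule.mem_bot]; exact LV_neg hk hw
    rw [this]; infer_instance
  · obtain ⟨k, rfl⟩ := Int.eq_ofNat_of_zero_le (not_lt.1 hk)
    exact Module.Finite.equiv (LVequiv B k).symm

lemma LV_finrank {m : ℕ} (B : Submodule K V) [FiniteDimensional K B] (t : ℕ) :
    finrank K (LV (n := m+1) B ((t:ℤ) - m)) = t.choose m * finrank K B := by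
  by_cases h : t < m
  · have : LV (n := m+1) B ((t:ℤ) - m) = ⊥ := by
      rw [eq_bot_iff]; intro w hw; rw [Submodule.mem_bot]; exact LV_neg (by omega) hw
    rw [this, finrank_bot, Nat.choose_eq_zero_of_lt h, zero_mul]
  · obtain ⟨k, rfl⟩ := Nat.exists_eq_add_of_le (not_lt.1 h)
    rw [show ((m + k : ℕ) : ℤ) - m = (k:ℕ) by push_cast; ring]
    rw [(LVequiv B k).finrank_eq, Module.finrank_pi_fintype]
    simp only [Finset.sum_const, smul_eq_mul, Finset.card_univ, Fintype.card_coe]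
    rw [card_finsuppAntidiag_nat_eq_choose]
    simp only [Finset.card_univ, Fintype.card_fin]
    rw [show m + 1 + k - 1 = m + k by omega, Nat.choose_symm_add]

lemma LD.euler (D : LD K n V) (t : ℤ) (hD : ∀ j : ℕ, D.DEx (t + j) j) (s : ℕ) :
    ∑ j ∈ range (s+1), (-1 : ℚ)^j * (finrank K (LV (n := n) (D.Z j) (t + j)) : ℚ) =
      (-1)^s * (finrank K ((LV (n := n) (D.Z (s+1)) (t + (s+1 : ℕ))).map D.Dn) : ℚ) := by
  have hex : ∀ j : ℕ, ∀ w ∈ LV (n := n) (D.Z j) (t+j), D.Dn w = 0 →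
      w ∈ (LV (n := n) (D.Z (j+1)) (t + (j+1 : ℕ))).map D.Dn := by
    intro j w hw h0
    obtain ⟨u, hu, rfl⟩ := hD j w hw h0
    refine ⟨u, ?_, rfl⟩
    rw [show t + ((j + 1 : ℕ) : ℤ) = t + j + 1 by push_cast; ring]; exact hu
  have hle : ∀ j : ℕ, (LV (n := n) (D.Z (j+1)) (t + (j+1 : ℕ))).map D.Dn ≤ LV (n := n) (D.Z j) (t+j) := by
    rintro j _ ⟨u, hu, rfl⟩
    refine D.Dn_mem ?_
    rw [show t + ((j + 1 : ℕ) : ℤ) = t + j + 1 by push_cast; ring] at hu; exact hu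
  induction s with
  | zero =>
    simp only [zero_add, Finset.sum_range_one, pow_zero, one_mul]
    have : (LV (n := n) (D.Z 0) (t+(0:ℕ))) = (LV (n := n) (D.Z (0+1)) (t + (0+1 : ℕ))).map D.Dn :=
      le_antisymm (fun w hw => hex 0 w hw (D.Dn_mem_zero hw)) (hle 0)
    rw [this]
  | succ s ih =>
    rw [Finset.sum_range_succ, ih]
    set L := LV (n := n) (D.Z (s+1)) (t + (s+1 : ℕ)) with hL
    set R := (LV (n := n) (D.Z (s+1+1)) (t + (s+1+1 : ℕ))).map D.Dn with hR
    have : FiniteDimensional K L := LV_finite _ _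
    have h1 := LinearMap.finrank_range_add_finrank_ker (D.Dn.domRestrict L)
    have h2 : LinearMap.range (D.Dn.domRestrict L) = L.map D.Dn := by
      rw [LinearMap.range_domRestrict]
    have h3 : LinearMap.ker (D.Dn.domRestrict L) = R.comap L.subtype := by
      ext ⟨w, hw⟩
      constructor
      · intro h0; exact hex (s+1) w hw h0
      · rintro ⟨u, _, hu⟩
        have hu : D.Dn u = w := hu
        show D.Dn w = 0
        rw [← hu, D.Dn_Dn]
    have h4 := (Submodule.comapSubtypeEquivOfLe (hle (s+1))).finrank_eq
    rw [h2, h3] at h1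
    rw [h4] at h1
    rw [← hR] at h1
    rw [← h1]
    rw [Nat.cast_add]
    ring

end dims

section hilb

lemma genHilb_eval (m t : ℕ) (a d : ℤ) (h : a - d - 1 = t) :
    (genHilb (m+1) a).eval (d : ℚ) = (-1)^m * (t.choose m : ℚ) := by
  unfold genHilb
  rw [if_neg (by omega)]
  simp only [Nat.add_sub_cancel, Polynomial.eval_mul, Polynomial.eval_C, Polynomial.eval_prod,
    Polynomial.eval_add, Polynomial.eval_sub, Polynomial.eval_X]
  have h' : (a:ℚ) = t + d + 1 := by
    have : a = t + d + 1 := by omega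
    rw [this]; push_cast; ring
  have : ∀ k ∈ range m, ((d:ℚ) - a + (k + 1)) = (-1) * ((t:ℚ) - k) := by
    intro k _; rw [h']; ring
  rw [Finset.prod_congr rfl this, Finset.prod_mul_distrib, Finset.prod_const, Finset.card_range]
  have h2 : ∏ k ∈ range m, ((t:ℚ) - k) = (t.descFactorial m : ℚ) := by
    rw [Nat.descFactorial_eq_prod_range]
    push_cast
    by_cases htm : m ≤ t
    · refine Finset.prod_congr rfl fun k hk => ?_
      rw [Nat.cast_sub]
      have := Finset.mem_range.1 hk; omega
    · rw [Finset.prod_eq_zero (i := t) (by simp; omega) (by simp),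
        Finset.prod_eq_zero (i := t) (by simp; omega) (by simp)]
  rw [h2, Nat.descFactorial_eq_factorial_mul_choose]
  have := Nat.factorial_ne_zero m
  push_cast
  field_simp

lemma genHilb_deg (m : ℕ) (a : ℤ) : (genHilb (m+1) a).natDegree ≤ m := by
  unfold genHilb
  rw [if_neg (by omega)]
  refine (Polynomial.natDegree_C_mul_le _ _).trans ?_
  refine (Polynomial.natDegree_prod_le _ _).trans ?_
  refine (Finset.sum_le_card_nsmul _ _ 1 ?_).trans (by simp)
  intro k _
  rw [sub_add_eq_add_sub, add_sub_assoc, ← Polynomial.C_sub]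
  exact (Polynomial.natDegree_X_add_C _).le

lemma poly_form {m : ℕ} (P : Polynomial ℚ) (z : Fin m → ℤ) (hz : Function.Injective z)
    (hd : P.natDegree ≤ m) (hP : P ≠ 0) (hr : ∀ l, P.eval (z l : ℚ) = 0) :
    ∃ a : ℚ, a ≠ 0 ∧ P = Polynomial.C a * ∏ i, (Polynomial.X - Polynomial.C (z i : ℚ)) := by
  have hinj : Function.Injective (fun l => (z l : ℚ)) := Int.cast_injective.comp hz
  have hdvd : ∏ i, (Polynomial.X - Polynomial.C (z i : ℚ)) ∣ P := by
    refine Finset.prod_dvd_of_coprime ?_ ?_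
    · intro i _ l _ h
      exact Polynomial.pairwise_coprime_X_sub_C hinj h
    · intro i _; exact Polynomial.dvd_iff_isRoot.2 (hr i)
  obtain ⟨Q, hQ⟩ := hdvd
  have hmon : (∏ i, (Polynomial.X - Polynomial.C (z i : ℚ))).Monic :=
    Polynomial.monic_prod_of_monic _ _ fun i _ => Polynomial.monic_X_sub_C _
  have hQ0 : Q ≠ 0 := by rintro rfl; simp at hQ; exact hP hQ
  have hdeg : (∏ i, (Polynomial.X - Polynomial.C (z i : ℚ))).natDegree = m := by
    rw [Polynomial.natDegree_prod_of_monic _ _ fun i _ => Polynomial.monic_X_sub_C _]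
    simp only [Polynomial.natDegree_X_sub_C]; simp
  have : Q.natDegree = 0 := by
    have h := hmon.natDegree_mul' hQ0
    rw [← hQ, hdeg] at h; omega
  rw [Polynomial.natDegree_eq_zero] at this
  obtain ⟨a, rfl⟩ := this
  refine ⟨a, fun h => hQ0 (by rw [h, map_zero]), ?_⟩
  rw [hQ, mul_comm]

variable {K : Type} [Field K] {V : Type} [AddCommGroup V] [Module K V]

lemma LD.hilb_eval {m : ℕ} (D : LD K (m+1) V) (N0 : ℤ) (hZ : ∀ j, m < j → D.Z j = ⊥) (d : ℤ) (t : ℕ)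
    (h : N0 - d - 1 = t) :
    (hilbPoly (D.F N0 m hZ)).eval (d : ℚ) =
      (-1)^m * ∑ j ∈ range (m+1), (-1:ℚ)^j * ((t+j).choose m * D.rk j : ℕ) := by
  unfold hilbPoly
  rw [Polynomial.eval_finsetSum, Finset.mul_sum]
  refine Finset.sum_congr rfl fun j _ => ?_
  have : ∀ p : Fin ((D.F N0 m hZ).rk j), (genHilb (m+1) ((D.F N0 m hZ).deg j p)).eval (d:ℚ) =
      (-1)^m * ((t+j).choose m : ℚ) := by
    intro p
    refine genHilb_eval m (t+j) _ d ?_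
    show N0 + j - d - 1 = _
    push_cast; omega
  rw [Polynomial.eval_mul, Polynomial.eval_finsetSum, Finset.sum_congr rfl fun p _ => this p]
  simp only [Polynomial.eval_C, Finset.sum_const, Finset.card_univ, Fintype.card_fin, nsmul_eq_mul]
  show (-1)^j * ((D.rk j : ℚ) * _) = _
  push_cast
  ring

lemma LD.hilb_deg {m : ℕ} (D : LD K (m+1) V) (N0 : ℤ) (hZ : ∀ j, m < j → D.Z j = ⊥) :
    (hilbPoly (D.F N0 m hZ)).natDegree ≤ m := by
  unfold hilbPoly
  refine Polynomial.natDegree_sum_le_of_forall_le _ _ fun j _ => ?_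
  refine (Polynomial.natDegree_C_mul_le _ _).trans ?_
  exact Polynomial.natDegree_sum_le_of_forall_le _ _ fun p _ => genHilb_deg m _

lemma LD.hilb_ne {m : ℕ} (D : LD K (m+1) V) (N0 : ℤ) (hZ : ∀ j, m < j → D.Z j = ⊥) (hm : D.Z m ≠ ⊥) :
    hilbPoly (D.F N0 m hZ) ≠ 0 := by
  intro h
  have := D.hilb_eval N0 hZ (N0 - 1) 0 (by simp)
  rw [h, Finset.sum_eq_single m] at this
  · simp at this
    have h2 : D.rk m = 0 := by exact_mod_cast this
    rw [LD.rk, Submodule.finrank_eq_zero] at h2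
    exact hm h2
  · intro j hj hjm
    rw [Nat.choose_eq_zero_of_lt]
    · simp
    · have := Finset.mem_range.1 hj; omega
  · simp

lemma LD.hilb_root {m : ℕ} (D : LD K (m+1) V) (N0 : ℤ) (hZ : ∀ j, m < j → D.Z j = ⊥) (d : ℤ) (hd : d < N0)
    (hD : ∀ j : ℕ, D.DEx (N0 - d - 1 - m + j) j) : (hilbPoly (D.F N0 m hZ)).eval (d : ℚ) = 0 := by
  obtain ⟨t, ht⟩ := Int.eq_ofNat_of_zero_le (show 0 ≤ N0 - d - 1 by omega)
  rw [D.hilb_eval N0 hZ d t ht]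
  have h := D.euler _ hD m
  have h0 : (LV (n := m+1) (D.Z (m+1)) (N0 - d - 1 - m + (m+1 : ℕ))) = ⊥ := by
    rw [eq_bot_iff, hZ (m+1) (by omega)]
    intro w hw
    rw [Submodule.mem_bot]
    funext α
    exact (hw α).1
  rw [h0, Submodule.map_bot, finrank_bot] at h
  simp only [Nat.cast_zero, mul_zero] at h
  rw [← mul_zero ((-1:ℚ)^m), ← h]
  congr 1
  refine Finset.sum_congr rfl fun j _ => ?_
  congr 2
  rw [show N0 - d - 1 - m + j = ((t+j : ℕ) : ℤ) - m by push_cast; omega, LV_finrank]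
  rfl

end hilb

section conc
variable {K : Type} [Field K] {m : ℕ}

theorem dex (z : Fin m → ℤ) (N0 : ℤ) (hN : ∀ l, z l + m + 2 ≤ N0) (d : ℤ) (j : ℕ)
    (h : N0 ≤ d ∨ m < j ∨ (∃ l, z l = d) ∨ j + (univ.filter (fun l => d < z l)).card ≠ m) :
    (bD K (fun l => N0 - 1 - z l)).DEx (N0 + j - d - (m+1)) j := by
  refine bD_DEx (fun l => ?_) _ j ?_ bD_Z_bot
  · have := hN l; omega
  · by_cases h1 : m < j
    · exact Or.inr (Or.inl h1)
    by_cases h2 : N0 ≤ d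
    · left; omega
    right; right
    have e : (j:ℤ) - (m+1) - (N0 + j - d - (m+1)) = d - N0 := by ring
    rw [e]
    refine ⟨by omega, ?_⟩
    rcases h.resolve_left h2 |>.resolve_left h1 with ⟨l, hl⟩ | h
    · exact Or.inl ⟨l, by omega⟩
    · right
      convert h using 4
      constructor <;> intro h <;> omega

theorem natural (z : Fin m → ℤ) (N0 : ℤ) (hN : ∀ l, z l + m + 2 ≤ N0) (i : ℕ) (d : ℤ)
    (h : sheafH ((bD K (fun l => N0 - 1 - z l)).F N0 m bD_Z_bot) i d ≠ 0) :
    i = (univ.filter (fun l => d < z l)).card := by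
  have key : ∀ j : ℕ, cohomDim (dualCo ((bD K (fun l => N0 - 1 - z l)).F N0 m bD_Z_bot)) j
      (-d - (m+1 : ℕ)) ≠ 0 → j + (univ.filter (fun l => d < z l)).card = m := by
    intro j hj
    by_contra hne
    refine hj (LD.cohom_zero _ _ _ _ _ _ ?_)
    have := dex (K := K) z N0 hN d j (Or.inr (Or.inr (Or.inr hne)))
    convert this using 1
    push_cast; ring
  unfold sheafH at h
  by_cases hi : i = 0
  · subst hi
    rw [if_pos rfl] at h
    by_cases hd : N0 ≤ d
    · symm
      rw [Finset.card_eq_zero, Finset.filter_eq_empty_iff]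
      intro l _
      have := hN l; omega
    · rw [LD.MPiece_zero _ _ _ _ _ (by omega), Nat.zero_sub, zero_add] at h
      unfold extDim at h
      rw [show ((m + 1 : ℕ) : ℤ) - 1 = (m : ℕ) by push_cast; ring, if_pos (by omega), Int.toNat_natCast] at h
      have := key m h
      omega
  · rw [if_neg hi] at h
    unfold extDim at h
    split_ifs at h with h1
    · have := key _ h
      push_cast at this h1
      omega
    · exact absurd rfl h

theorem supernat (z : Fin m → ℤ) (hz : StrictAnti z) (N0 : ℤ) (hN : ∀ l, z l + m + 2 ≤ N0) :
    IsSupernaturalWithRoots ((bD K (fun l => N0 - 1 - z l)).F N0 m bD_Z_bot) z := by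
  refine ⟨hz, fun d i i' h h' => ?_, ?_⟩
  · rw [natural z N0 hN i d h, natural z N0 hN i' d h']
  · refine poly_form _ z hz.injective (LD.hilb_deg _ _ _) (LD.hilb_ne _ _ _ (bD_Zm_ne fun l => ?_)) fun l => ?_
    · have := hN l; omega
    · refine LD.hilb_root _ _ _ _ ?_ fun j => ?_
      · have := hN l; omega
      · have := dex (K := K) z N0 hN (z l) j (Or.inr (Or.inr (Or.inl ⟨l, rfl⟩)))
        convert this using 1
        ring

end conc
end SNB
end

noncomputable section
namespace SNB

section minors
variable {L : Type} [Field L]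

lemma exists_rows {a b : ℕ} (M : Matrix (Fin a) (Fin b) L) :
    ∃ e : Fin M.rank ↪ Fin a, LinearIndependent L (M.submatrix e id).row := by
  obtain ⟨κ, f, hf, hsp, hli⟩ := exists_linearIndependent' L M.row
  have : Fintype κ := Fintype.ofInjective f hf
  have hc : Fintype.card κ = M.rank := by
    rw [Matrix.rank_eq_finrank_span_row, ← hsp, finrank_span_eq_card hli]
  let g : Fin M.rank ≃ κ := (Fintype.equivFinOfCardEq hc).symm
  exact ⟨⟨f ∘ g, hf.comp g.injective⟩, hli.comp g g.injective⟩

lemma exists_minor {a b s : ℕ} (M : Matrix (Fin a) (Fin b) L) (hs : M.rank = s) :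
    ∃ (e : Fin s ↪ Fin a) (f : Fin s ↪ Fin b), (M.submatrix e f).det ≠ 0 := by
  subst hs
  obtain ⟨e, he⟩ := exists_rows M
  have h1 : (M.submatrix e id).rank = M.rank := by rw [he.rank_matrix, Fintype.card_fin]
  have h2 : (M.submatrix e id).transpose.rank = M.rank := by rw [Matrix.rank_transpose, h1]
  obtain ⟨f, hf⟩ := exists_rows (M.submatrix e id).transpose
  let f' : Fin M.rank ↪ Fin b := (finCongr h2.symm).toEmbedding.trans f
  refine ⟨e, f', ?_⟩
  have h3 : LinearIndependent L (M.submatrix e f').transpose.row :=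
    hf.comp (finCongr h2.symm) (finCongr h2.symm).injective
  rw [Matrix.linearIndependent_rows_iff_isUnit, Matrix.isUnit_iff_isUnit_det, Matrix.det_transpose] at h3
  exact h3.ne_zero

lemma minor_zero {a b s : ℕ} (M : Matrix (Fin a) (Fin b) L) (hs : M.rank < s)
    (e : Fin s → Fin a) (f : Fin s → Fin b) : (M.submatrix e f).det = 0 := by
  by_contra h
  have h1 := Matrix.rank_of_det_ne_zero h
  have h2 := Matrix.rank_submatrix_le M e f
  rw [h1, Fintype.card_fin] at h2
  omega

end minors

section vb
variable {K : Type} [Field K] {n : ℕ} {V : Type} [AddCommGroup V] [Module K V]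

lemma Hom_X {r : ℕ} (i : Fin n) {v : Fin r → PolyS K n} {k : ℕ} (h : Hom v k) (N : ℕ) :
    Hom ((X i : PolyS K n)^N • v) (k+N) := by
  induction N with
  | zero => simpa using h
  | succ N ih =>
    intro α hα
    funext q
    rw [pow_succ', mul_smul]
    show coeff α (X i * (((X i : PolyS K n)^N • v) q)) = 0
    rw [mul_comm, coeff_mul_X']
    split_ifs with h1
    · have h2 : 1 ≤ α i := by rw [Finsupp.mem_support_iff] at h1; omega
      have h3 := deg_sub_e1' h2
      exact congrFun (ih (α - e1 i) (by omega)) q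
    · rfl

lemma LD.ann (D : LD K n V) (j k0 : ℕ) (hD : ∀ k : ℕ, k0 ≤ k → D.DEx k (j+1)) (i : Fin n)
    (v : Fin (D.rk (j+1)) → PolyS K n) (h0 : (D.dd (j+1)).transpose.mulVec v = 0) :
    (X i : PolyS K n)^k0 • v ∈ LinearMap.range (D.dd j).transpose.mulVecLin := by
  refine ker_of_hom (fun l => (D.mat (j+1) l).transpose) v h0
    ((LinearMap.range (D.dd j).transpose.mulVecLin).comap (LinearMap.lsmul _ _ ((X i : PolyS K n)^k0))) ?_
  intro k u hu h1
  refine D.dual_succ (k+k0) j (hD _ (by omega)) _ (Hom_X i hu k0) ?_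
  have h1 : (D.dd (j+1)).transpose.mulVec u = 0 := h1
  rw [LinearMap.lsmul_apply, Matrix.mulVec_smul]
  rw [h1, smul_zero]

lemma LD.homotopy (D : LD K n V) (m : ℕ) (hZ : ∀ j, m < j → D.Z j = ⊥)
    (hD : ∀ j : ℕ, ∃ k0 : ℕ, ∀ k : ℕ, k0 ≤ k → D.DEx k (j+1)) (i : Fin n) (t j : ℕ) (hj : m ≤ j + t) :
    ∃ (N : ℕ) (A : Matrix (Fin (D.rk j)) (Fin (D.rk (j+1))) (PolyS K n))
      (B : Matrix (Fin (D.rk (j+1))) (Fin (D.rk (j+1+1))) (PolyS K n)),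
      (D.dd j).transpose * A + B * (D.dd (j+1)).transpose = (X i : PolyS K n)^N • 1 := by
  induction t generalizing j with
  | zero =>
    refine ⟨0, 0, 0, ?_⟩
    have : D.rk (j+1) = 0 := by rw [LD.rk, hZ _ (by omega), finrank_bot]
    have : IsEmpty (Fin (D.rk (j+1))) := by rw [this]; infer_instance
    ext p; exact this.elim p
  | succ t ih =>
    obtain ⟨N, A', B', h⟩ := ih (j+1) (by omega)
    obtain ⟨k0, hk0⟩ := hD j
    set G := (X i : PolyS K n)^N • (1 : Matrix (Fin (D.rk (j+1))) (Fin (D.rk (j+1))) (PolyS K n)) -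
      A' * (D.dd (j+1)).transpose with hG
    have hG0 : (D.dd (j+1)).transpose * G = 0 := by
      have e : (D.dd (j+1)).transpose * A' = (X i : PolyS K n)^N • 1 - B' * (D.dd (j+1+1)).transpose :=
        eq_sub_of_add_eq h
      rw [hG, Matrix.mul_sub, Matrix.mul_smul, Matrix.mul_one, ← Matrix.mul_assoc, e, Matrix.sub_mul,
        Matrix.mul_assoc, ← Matrix.transpose_mul, D.dd_dd, Matrix.transpose_zero, Matrix.mul_zero, sub_zero,
        Matrix.smul_mul, Matrix.one_mul, sub_self]
    have hcol : ∀ p, ∃ u : Fin (D.rk j) → PolyS K n,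
        (D.dd j).transpose.mulVec u = (X i : PolyS K n)^k0 • G.col p := by
      intro p
      refine D.ann j k0 hk0 i (G.col p) ?_
      have := congrArg (fun Q => Matrix.col Q p) hG0
      exact this
    choose u hu using hcol
    refine ⟨k0 + N, Matrix.of fun q p => u p q, (X i : PolyS K n)^k0 • A', ?_⟩
    have e : (D.dd j).transpose * (Matrix.of fun q p => u p q) = (X i : PolyS K n)^k0 • G := by
      ext1 q p
      exact congrFun (hu p) q
    rw [e, hG, smul_sub, Matrix.smul_mul, sub_add_cancel, smul_smul, pow_add]

lemma LD.rank_const (D : LD K n V) (m : ℕ) (hZ : ∀ j, m < j → D.Z j = ⊥)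
    (hD : ∀ j : ℕ, ∃ k0 : ℕ, ∀ k : ℕ, k0 ≤ k → D.DEx k (j+1)) (t j : ℕ) (hj : m ≤ j + t) :
    ∃ ρ : ℕ, ∀ (L : Type) [Field L] (φ : PolyS K n →+* L) (i : Fin n), φ (X i) ≠ 0 →
      ((D.dd j).transpose.map φ).rank = ρ := by
  induction t generalizing j with
  | zero =>
    refine ⟨0, fun L _ φ i _ => ?_⟩
    have : D.rk (j+1) = 0 := by rw [LD.rk, hZ _ (by omega), finrank_bot]
    have h := Matrix.rank_le_height ((D.dd j).transpose.map φ)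
    omega
  | succ t ih =>
    obtain ⟨ρ, hρ⟩ := ih (j+1) (by omega)
    refine ⟨D.rk (j+1) - ρ, fun L _ φ i hi => ?_⟩
    have h1 := hρ L φ i hi
    obtain ⟨N, A, B, hh⟩ := D.homotopy m hZ hD i m j (by omega)
    have h2 : LinearMap.ker ((D.dd (j+1)).transpose.map φ).mulVecLin =
        LinearMap.range ((D.dd j).transpose.map φ).mulVecLin := by
      refine le_antisymm ?_ ?_
      · intro v hv
        have hv : ((D.dd (j+1)).transpose.map φ).mulVec v = 0 := hv
        have h3 := congrArg (fun Q => (Q.map φ).mulVec v) hh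
        have e1 : ((X i : PolyS K n)^N • (1 : Matrix (Fin (D.rk (j+1))) (Fin (D.rk (j+1))) (PolyS K n))).map φ
            = (φ (X i))^N • 1 := by
          ext p q
          simp only [Matrix.map_apply, Matrix.smul_apply, smul_eq_mul, map_mul, map_pow, Matrix.one_apply]
          split_ifs <;> simp
        rw [e1, Matrix.map_add _ (map_add φ), Matrix.map_mul, Matrix.map_mul, Matrix.add_mulVec,
          ← Matrix.mulVec_mulVec, ← Matrix.mulVec_mulVec, hv, Matrix.mulVec_zero, add_zero, Matrix.smul_mulVec,
          Matrix.one_mulVec] at h3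
        have h4 : v = ((φ (X i))^N)⁻¹ • ((φ (X i))^N • v) := by
          rw [smul_smul, inv_mul_cancel₀ (pow_ne_zero _ hi), one_smul]
        rw [h4, ← h3]
        exact Submodule.smul_mem _ _ ⟨_, rfl⟩
      · rintro _ ⟨v, rfl⟩
        show ((D.dd (j+1)).transpose.map φ).mulVec (((D.dd j).transpose.map φ).mulVec v) = 0
        rw [Matrix.mulVec_mulVec, ← Matrix.map_mul, ← Matrix.transpose_mul, D.dd_dd]
        simp
    have h5 := LinearMap.finrank_range_add_finrank_ker ((D.dd (j+1)).transpose.map φ).mulVecLin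
    rw [h2] at h5
    simp only [Module.finrank_fintype_fun_eq_card, Fintype.card_fin] at h5
    change ((D.dd (j+1)).transpose.map φ).rank + ((D.dd j).transpose.map φ).rank = D.rk (j+1) at h5
    omega

lemma LD.isVB {m : ℕ} (D : LD K (m+1) V) (N0 : ℤ) (hZ : ∀ j, m < j → D.Z j = ⊥)
    (hD : ∀ j : ℕ, ∃ k0 : ℕ, ∀ k : ℕ, k0 ≤ k → D.DEx k (j+1)) :
    ∃ r, IsVectorBundle (D.F N0 m hZ) r := by
  obtain ⟨ρ, hρ'⟩ := D.rank_const m hZ hD m 0 (by omega)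
  have hρ : ∀ (L : Type) [Field L] (φ : PolyS K (m+1) →+* L) (i : Fin (m+1)), φ (X i) ≠ 0 →
      ((D.dd 0).map φ).rank = ρ := by
    intro L _ φ i hi
    rw [← hρ' L φ i hi, ← Matrix.rank_transpose]; rfl
  have hdet : ∀ (L : Type) [Field L] (φ : PolyS K (m+1) →+* L) (s : ℕ) (e : Fin s → Fin (D.rk 0))
      (f : Fin s → Fin (D.rk (0+1))),
      φ ((D.dd 0).submatrix e f).det = (((D.dd 0).map φ).submatrix e f).det := by
    intro L _ φ s e f
    rw [RingHom.map_det]; rfl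
  let φ0 := algebraMap (PolyS K (m+1)) (FractionRing (PolyS K (m+1)))
  have hφ0 : Function.Injective φ0 := IsFractionRing.injective _ _
  have hX0 : φ0 (X 0) ≠ 0 := by
    rw [map_ne_zero_iff _ hφ0]; exact X_ne_zero 0
  have hr0 := hρ _ φ0 0 hX0
  have hle : ρ ≤ D.rk 0 := by rw [← hr0]; exact Matrix.rank_le_height _
  have hrk : (D.F N0 m hZ).rk 0 = D.rk 0 := rfl
  refine ⟨D.rk 0 - ρ, ?_, ?_⟩
  · unfold fittingIdeal
    have e : (((D.F N0 m hZ).rk 0 : ℕ) : ℤ) - (((D.rk 0 - ρ : ℕ) : ℤ) - 1) = ((ρ+1 : ℕ) : ℤ) := by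
      rw [hrk]; omega
    rw [if_neg (by omega), e, Int.toNat_natCast, minorsIdeal, Ideal.span_eq_bot]
    rintro _ ⟨⟨e, f⟩, rfl⟩
    apply hφ0
    rw [map_zero]
    refine (hdet _ φ0 _ e f).trans ?_
    exact minor_zero _ (by omega) _ _
  · unfold fittingIdeal
    have e : (((D.F N0 m hZ).rk 0 : ℕ) : ℤ) - ((D.rk 0 - ρ : ℕ) : ℤ) = (ρ : ℤ) := by
      rw [hrk]; omega
    rw [e, Int.toNat_natCast]
    split_ifs with h0
    · exact ⟨0, le_top⟩
    · refine Ideal.exists_pow_le_of_le_radical_of_fg ?_ ?_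
      · rw [Ideal.radical_eq_sInf, le_sInf_iff]
        rintro P ⟨hP, hprime⟩
        rw [irrel, Ideal.span_le]
        rintro _ ⟨i, rfl⟩
        by_contra hi
        let φ : PolyS K (m+1) →+* FractionRing (PolyS K (m+1) ⧸ P) :=
          (algebraMap (PolyS K (m+1) ⧸ P) _).comp (Ideal.Quotient.mk P)
        have hφ : ∀ x, φ x = 0 ↔ x ∈ P := by
          intro x
          rw [← Ideal.Quotient.eq_zero_iff_mem]
          exact map_eq_zero_iff (algebraMap (PolyS K (m+1) ⧸ P) (FractionRing (PolyS K (m+1) ⧸ P)))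
            (IsFractionRing.injective _ _)
        obtain ⟨e, f, hef⟩ := exists_minor _ (hρ _ φ i (fun h => hi ((hφ _).1 h)))
        refine hef ?_
        rw [← hdet, hφ]
        exact hP (Ideal.subset_span ⟨(e, f), rfl⟩)
      · exact Submodule.fg_span (Set.finite_range _)

end vb

section final
variable {K : Type} [Field K] {m : ℕ}

lemma dex_large (z : Fin m → ℤ) (N0 : ℤ) (hN : ∀ l, z l + m + 2 ≤ N0) (j : ℕ) :
    ∃ k0 : ℕ, ∀ k : ℕ, k0 ≤ k → (bD K (fun l => N0 - 1 - z l)).DEx k (j+1) := by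
  let B : ℤ := ∑ l, |z l|
  have hB : ∀ l, -B ≤ z l := by
    intro l
    have h1 : |z l| ≤ B := Finset.single_le_sum (f := fun l => |z l|) (fun _ _ => abs_nonneg _) (mem_univ l)
    have := neg_abs_le (z l)
    omega
  refine ⟨(N0 + (j+1) + B + 1).toNat, fun k hk => ?_⟩
  have hd := dex (K := K) z N0 hN (N0 + (j+1) - (m+1) - k) (j+1) ?_
  · convert hd using 1
    push_cast; ring
  · right; right; right
    rw [Finset.filter_true_of_mem]
    · simp
    · intro l _
      have := hB l
      omega

end final
end SNB

/-- For every strictly decreasing sequence of `n - 1` integers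
`z_1 > ⋯ > z_{n-1}`, there exists a vector bundle on `ℙ^{n-1}_K` with
supernatural cohomology whose root sequence is `(z_1, …, z_{n-1})`.
(Here `m = n - 1`, the bundle is the sheaf associated to `coker (F₁ → F₀)`.) -/
theorem supernatural_bundles_exist (K : Type) [Field K] (m : ℕ)
    (z : Fin m → ℤ) (hz : StrictAnti z) :
    ∃ (F : FreeComplex K (m + 1)) (r : ℕ),
      IsResolution F ∧ IsVectorBundle F r ∧ IsSupernaturalWithRoots F z := by
  obtain ⟨N0, hN⟩ : ∃ N0 : ℤ, ∀ l, z l + m + 2 ≤ N0 := by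
    refine ⟨∑ l, |z l| + m + 2, fun l => ?_⟩
    have h1 : |z l| ≤ ∑ l, |z l| :=
      Finset.single_le_sum (f := fun l => |z l|) (fun _ _ => abs_nonneg _) (mem_univ l)
    have := le_abs_self (z l)
    omega
  obtain ⟨r, hr⟩ := SNB.LD.isVB (SNB.bD K (fun l => N0 - 1 - z l)) N0 SNB.bD_Z_bot
    (SNB.dex_large z N0 hN)
  refine ⟨_, r, ?_, hr, SNB.supernat z hz N0 hN⟩
  exact SNB.LD.res _ (SNB.bD_SE fun l => by have := hN l; omega)

end
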